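/- Let $q$ and $p$ be primes with $q \equiv 3 \pmod 8$ and $p \equiv 5 \pmod 8$, and let $d = qp$. Then the 2-class group of $L_d = \mathbb{Q}(\zeta_8, \sqrt{d})$ is cyclic and nontrivial. -/

import Mathlib

open NumberField

namespace LdProof

/-- The ring of integers of `ℚ(ζ₈)` is principal. -/
theorem pid8 (K : Type) [Field K] [NumberField K] [hK : IsCyclotomicExtension {8} ℚ K] :
    IsPrincipalIdealRing (𝓞 K) := by
  have : Fact (Nat.Prime 2) := ⟨Nat.prime_two⟩
  have hK' : IsCyclotomicExtension {2 ^ (2 + 1)} ℚ K := by simpa using hK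
  have : IsGalois ℚ K := IsCyclotomicExtension.isGalois {8} ℚ K
  apply RingOfIntegers.isPrincipalIdealRing_of_isPrincipal_of_lt_or_isPrincipal_of_mem_primesOver_of_mem_Icc
  have htot : Nat.totient 8 = 4 := by decide
  have hfin : Module.finrank ℚ K = 4 := by
    rw [IsCyclotomicExtension.finrank (n := 8) K (Polynomial.cyclotomic.irreducible_rat (by norm_num)), htot]
  have hdisc : |(NumberField.discr K : ℤ)| = 256 := by
    have := IsCyclotomicExtension.Rat.natAbs_discr 8 K
    rw [htot] at this
    have h2 : (8 : ℕ).primeFactors = {2} := by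
      have : (8 : ℕ) = 2 ^ 3 := by norm_num
      rw [this, Nat.primeFactors_prime_pow (by norm_num) Nat.prime_two]
    rw [h2] at this
    simp at this
    rw [Int.abs_eq_natAbs, this]; norm_num
  have hM : (4 / Real.pi) ^ NumberField.InfinitePlace.nrComplexPlaces K *
      ((Module.finrank ℚ K).factorial / (Module.finrank ℚ K) ^ (Module.finrank ℚ K) *
        Real.sqrt |(NumberField.discr K : ℝ)|) < 3 := by
    have h1 : |(NumberField.discr K : ℝ)| = 256 := by
      have : ((|(NumberField.discr K : ℤ)| : ℤ) : ℝ) = 256 := by rw [hdisc]; norm_num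
      simpa using this
    rw [IsCyclotomicExtension.Rat.nrComplexPlaces_eq_totient_div_two 8, htot, hfin, h1,
      show (256 : ℝ) = 16 ^ 2 by norm_num, Real.sqrt_sq (by norm_num)]
    have : (4 / Real.pi) ^ (4 / 2) < (4 / 3) ^ 2 := by
      have := Real.pi_gt_three
      gcongr <;> norm_num
    norm_num [Nat.factorial] at *
    nlinarith
  intro p hp hpp
  have hlt : ⌊(4 / Real.pi) ^ NumberField.InfinitePlace.nrComplexPlaces K *
      ((Module.finrank ℚ K).factorial / (Module.finrank ℚ K) ^ (Module.finrank ℚ K) *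
        Real.sqrt |(NumberField.discr K : ℝ)|)⌋₊ < 3 := by
    rw [Nat.floor_lt' (by norm_num)]; exact_mod_cast hM
  have hp2 : p = 2 := by
    have h1 := (Finset.mem_Icc.mp hp).2
    have h2 := hpp.two_le
    have : p < 3 := lt_of_le_of_lt h1 hlt
    omega
  subst hp2
  have hζ := hK'.zeta_spec
  refine ⟨Ideal.span {hζ.toInteger - 1}, ⟨IsCyclotomicExtension.Rat.isPrime_span_zeta_sub_one 2 2 hζ,
    IsCyclotomicExtension.Rat.liesOver_span_zeta_sub_one 2 2 hζ⟩, Or.inr ⟨⟨_, rfl⟩⟩⟩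

theorem index_aux {U : Type} [CommGroup U] (T : Subgroup U) {r : ℕ}
    (b : Module.Basis (Fin r) ℤ (Additive (U ⧸ T))) :
    ((powMonoidHom 2 : U →* U).range ⊔ T).index = 2 ^ r := by
  let g : U →* Multiplicative (Fin (r) → ZMod 2) :=
    { toFun := fun x => Multiplicative.ofAdd
        (fun i => ((b.repr (Additive.ofMul (QuotientGroup.mk x)) i : ℤ) : ZMod 2))
      map_one' := by
        rw [QuotientGroup.mk_one, ofMul_one, map_zero]
        simp
        rfl
      map_mul' := by
        intro x y
        rw [QuotientGroup.mk_mul, ofMul_mul, map_add]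
        simp
        rfl }
  have hg : ∀ x, g x = Multiplicative.ofAdd
        (fun i => ((b.repr (Additive.ofMul (QuotientGroup.mk x)) i : ℤ) : ZMod 2)) := fun _ => rfl
  have hker : g.ker = (powMonoidHom 2 : U →* U).range ⊔ T := by
    apply le_antisymm
    · intro x hx
      rw [MonoidHom.mem_ker, hg] at hx
      have hx' : ∀ i, ((b.repr (Additive.ofMul (QuotientGroup.mk x)) i : ℤ) : ZMod 2) = 0 :=
        fun i => congrFun (Multiplicative.ofAdd.injective hx) i
      have h6 : ∀ i, ∃ c : ℤ, b.repr (Additive.ofMul (QuotientGroup.mk x)) i = 2 * c := by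
        intro i
        have := (ZMod.intCast_zmod_eq_zero_iff_dvd _ 2).mp (hx' i)
        exact this
      choose c hc using h6
      obtain ⟨y, hy⟩ := QuotientGroup.mk_surjective (Additive.toMul (∑ i, c i • b i))
      have h7 : (QuotientGroup.mk x : U ⧸ T) = QuotientGroup.mk (y ^ 2) := by
        apply Additive.ofMul.injective
        apply b.repr.injective
        ext i
        rw [hc, QuotientGroup.mk_pow, hy, ofMul_pow, ofMul_toMul, map_nsmul]
        simp [Finsupp.single_apply]
      have h8 : (y ^ 2)⁻¹ * x ∈ T := by
        exact QuotientGroup.eq.mp h7.symm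
      have : x = y ^ 2 * ((y ^ 2)⁻¹ * x) := by group
      rw [this]
      exact mul_mem (Subgroup.mem_sup_left ⟨y, rfl⟩) (Subgroup.mem_sup_right h8)
    · apply sup_le
      · rintro _ ⟨y, rfl⟩
        rw [MonoidHom.mem_ker, powMonoidHom_apply, map_pow]
        apply Multiplicative.toAdd.injective
        funext i
        rw [toAdd_pow, toAdd_one, Pi.smul_apply, two_nsmul]
        exact CharTwo.add_self_eq_zero _
      · intro x hx
        rw [MonoidHom.mem_ker, hg, (QuotientGroup.eq_one_iff x).mpr hx, ofMul_one, map_zero]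
        simp
        rfl
  have hsurj : Function.Surjective g := by
    intro f
    obtain ⟨y, hy⟩ := QuotientGroup.mk_surjective
      (Additive.toMul (∑ i, ((Multiplicative.toAdd f i).val : ℤ) • b i))
    refine ⟨y, ?_⟩
    rw [hg, hy]
    apply Multiplicative.toAdd.injective
    funext i
    simp [Finsupp.single_apply]
  rw [← hker, Subgroup.index_ker, MonoidHom.range_eq_top.mpr hsurj]
  simp

/-- index of squares in the unit group -/
theorem unit_index (F : Type) [Field F] [NumberField F] :
    (powMonoidHom 2 : (𝓞 F)ˣ →* (𝓞 F)ˣ).range.index = 2 ^ (NumberField.Units.rank F + 1) := by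
  classical
  set T := NumberField.Units.torsion F
  set S := (powMonoidHom 2 : (𝓞 F)ˣ →* (𝓞 F)ˣ).range with hS
  have h1 : S.relIndex (S ⊔ T) * (S ⊔ T).index = S.index := Subgroup.relIndex_mul_index le_sup_left
  have h2 : S.relIndex (S ⊔ T) = 2 := by
    rw [Subgroup.relIndex_sup_left]
    have h3 : S ⊓ T = ((powMonoidHom 2 : T →* T).range).map T.subtype := by
      ext x
      simp only [Subgroup.mem_inf, Subgroup.mem_map, MonoidHom.mem_range, hS]
      constructor
      · rintro ⟨⟨y, rfl⟩, hx⟩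
        have hy : y ∈ T := by
          rw [powMonoidHom_apply] at hx
          have : IsOfFinOrder (y ^ 2) := hx
          exact (isOfFinOrder_pow.mp this).resolve_right (by norm_num)
        exact ⟨⟨y, hy⟩ ^ 2, ⟨⟨y, hy⟩, rfl⟩, rfl⟩
      · rintro ⟨_, ⟨y, rfl⟩, rfl⟩
        exact ⟨⟨y, by simp⟩, (y ^ 2 : T).2⟩
    have h3' : (powMonoidHom 2 : T →* T).range.map T.subtype = T.map (powMonoidHom 2) := by
      ext x
      simp only [Subgroup.mem_map, MonoidHom.mem_range]
      constructor
      · rintro ⟨_, ⟨y, rfl⟩, rfl⟩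
        exact ⟨y, y.2, rfl⟩
      · rintro ⟨y, hy, rfl⟩
        exact ⟨_, ⟨⟨y, hy⟩, rfl⟩, rfl⟩
    rw [← Subgroup.inf_relIndex_right, h3, h3', Subgroup.relIndex,
      Subgroup.subgroupOf_map_powMonoidHom_eq_range, IsCyclic.index_powMonoidHom_range]
    rw [Nat.gcd_eq_right_iff_dvd]
    exact (NumberField.Units.even_torsionOrder F).two_dvd
  have h5 : (S ⊔ T).index = 2 ^ NumberField.Units.rank F := by
    exact index_aux T (NumberField.Units.basisModTorsion F)
  rw [← h1, h2, h5, pow_succ, mul_comm]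

end LdProof

namespace LdProof

theorem M_index {X : Type} [CommGroup X] (U K M : Subgroup X) (z : X)
    (hU : U = M ⊔ K) (hMK : ∀ x ∈ M, x ∈ K → x = 1 ∨ x = z) (hzM : z ∈ M) (hzK : z ∈ K)
    (hz2 : z ^ 2 = 1) (hzn : ∀ m ∈ M, m ^ 2 ≠ z)
    (F2 : ∀ x ∈ U, x ^ 2 ∈ K → ∃ k ∈ K, x ^ 2 = k ^ 2)
    (hUi : (U.map (powMonoidHom 2)).relIndex U = 16)
    (hKi : (K.map (powMonoidHom 2)).relIndex K = 4) :
    (M.map (powMonoidHom 2)).relIndex M = 8 := by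
  set U2 := U.map (powMonoidHom 2) with hU2
  set K2 := K.map (powMonoidHom 2) with hK2
  set M2 := M.map (powMonoidHom 2) with hM2
  have hMU : M ≤ U := hU ▸ le_sup_left
  have hKU : K ≤ U := hU ▸ le_sup_right
  have sqle : ∀ A : Subgroup X, A.map (powMonoidHom 2) ≤ A := by
    rintro A _ ⟨y, hy, rfl⟩
    exact pow_mem hy 2
  have hU2e : U2 = M2 ⊔ K2 := by rw [hU2, hU, Subgroup.map_sup]
  have hN : K ⊔ M2 = K ⊔ U2 := by
    rw [hU2e, ← sup_assoc]
    apply le_antisymm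
    · exact le_sup_left
    · exact sup_le le_rfl ((sqle K).trans le_sup_left)
  have hNU : K ⊔ M2 ≤ U := sup_le hKU ((sqle M).trans hMU)
  have a := Subgroup.relIndex_mul_relIndex U2 (K ⊔ M2) U (hN ▸ le_sup_right) hNU
  have b : U2.relIndex (K ⊔ M2) = 4 := by
    rw [hN, Subgroup.relIndex_sup_right, ← Subgroup.inf_relIndex_right, ← hKi]
    congr 1
    apply le_antisymm
    · rintro _ ⟨⟨y, hy, rfl⟩, hx⟩
      obtain ⟨k, hk, h⟩ := F2 y hy hx
      exact ⟨k, hk, h.symm⟩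
    · exact le_inf (hU2e ▸ le_sup_right) (sqle K)
  have c : (K ⊔ M2).relIndex U = 4 := by
    rw [b, hUi] at a; omega
  have c1 : U = M ⊔ (K ⊔ M2) := by
    apply le_antisymm
    · rw [hU]; exact sup_le le_sup_left (le_sup_left.trans le_sup_right)
    · exact sup_le hMU hNU
  have c2 : ((K ⊔ M2) ⊓ M).relIndex M = 4 := by
    rw [Subgroup.inf_relIndex_right, ← c]
    conv_rhs => rw [c1]
    rw [Subgroup.relIndex_sup_right]
  have d : M2.relIndex ((K ⊔ M2) ⊓ M) = 2 := by
    rw [Subgroup.relIndex_eq_two_iff]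
    refine ⟨z, ⟨Subgroup.mem_sup_left hzK, hzM⟩, ?_⟩
    rintro x ⟨hx, hxM⟩
    obtain ⟨k, hk, m, hm, rfl⟩ := Subgroup.mem_sup.mp hx
    have hkM : k ∈ M := by
      have hxM : k * m ∈ M := hxM
      have := mul_mem hxM (inv_mem (sqle M hm))
      simpa using this
    have hznM : z ∉ M2 := by
      rintro ⟨m, hm, h⟩
      exact hzn m hm h
    rcases hMK k hkM hk with rfl | rfl
    · right
      refine ⟨by simpa using hm, ?_⟩
      intro h
      apply hznM
      have := mul_mem (inv_mem hm) h
      simpa using this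
    · left
      constructor
      · have : k * m * k = m := by
          rw [mul_right_comm, ← sq, hz2, one_mul]
        rwa [this]
      · intro h
        apply hznM
        have := mul_mem h (inv_mem hm)
        simpa using this
  have e := Subgroup.relIndex_mul_relIndex M2 ((K ⊔ M2) ⊓ M) M
    (le_inf le_sup_right (sqle M)) inf_le_right
  rw [d, c2] at e
  omega

theorem card_pow_two {G : Type} [CommGroup G] [Finite G] (t : G)
    (h : ∀ c : G, c ^ 2 = 1 → c = 1 ∨ c = t) (k : ℕ) :
    Nat.card (powMonoidHom (2 ^ k) : G →* G).ker ≤ 2 ^ k := by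
  have h2 : Nat.card (powMonoidHom 2 : G →* G).ker ≤ 2 := by
    have hs : ((powMonoidHom 2 : G →* G).ker : Set G) ⊆ {1, t} := by
      intro c hc
      exact h c hc
    have := Set.ncard_le_ncard hs (Set.toFinite _)
    exact (this.trans (by
      have := Set.ncard_insert_le (1 : G) {t}
      simpa using this))
  induction k with
  | zero =>
    have : (powMonoidHom (2 ^ 0) : G →* G).ker = ⊥ := by
      ext x; simp [MonoidHom.mem_ker]
    rw [this]; simp
  | succ k ih =>
    let A := (powMonoidHom (2 ^ (k + 1)) : G →* G).ker
    let B := (powMonoidHom (2 ^ k) : G →* G).ker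
    have h3 : Nat.card (A.map (powMonoidHom 2)) ≤ Nat.card B := by
      apply Nat.card_mono (Set.toFinite _)
      rintro _ ⟨y, hy, rfl⟩
      have : y ^ (2 ^ (k + 1)) = 1 := hy
      change (y ^ 2) ^ (2 ^ k) = 1
      rw [← pow_mul, ← this, pow_succ, mul_comm]
    have h4 : (powMonoidHom 2 : G →* G).ker.relIndex A = Nat.card (A.map (powMonoidHom 2)) :=
      Subgroup.relIndex_ker A _
    have h5 : Nat.card A = Nat.card (powMonoidHom 2 : G →* G).ker *
        (powMonoidHom 2 : G →* G).ker.relIndex A := by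
      have := Subgroup.relIndex_mul_relIndex ⊥ (powMonoidHom 2 : G →* G).ker A bot_le (by
        intro x hx
        have hx : x ^ 2 = 1 := hx
        change x ^ (2 ^ (k + 1)) = 1
        rw [pow_succ, mul_comm, pow_mul, hx, one_pow])
      rw [Subgroup.relIndex_bot_left, Subgroup.relIndex_bot_left] at this
      exact this.symm
    change Nat.card A ≤ _
    rw [h5, h4, pow_succ, mul_comm]
    exact Nat.mul_le_mul (h3.trans ih) h2

theorem sylow_final {G : Type} [CommGroup G] [Finite G] (t : G) (ht1 : t ≠ 1) (ht : t ^ 2 = 1)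
    (h : ∀ c : G, c ^ 2 = 1 → c = 1 ∨ c = t) (P : Sylow 2 G) : IsCyclic P ∧ Nontrivial P := by
  classical
  have : Fact (Nat.Prime 2) := ⟨Nat.prime_two⟩
  have hfin : Fintype P := Fintype.ofFinite P
  constructor
  · apply isCyclic_of_card_pow_eq_one_le
    intro n hn
    obtain ⟨k, m, hm, rfl⟩ := Nat.exists_eq_two_pow_mul_odd hn.ne'
    have h1 : Nat.card (powMonoidHom (2 ^ k) : G →* G).ker ≤ 2 ^ k := card_pow_two t h k
    rw [← Fintype.card_subtype, ← Nat.card_eq_fintype_card]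
    refine le_trans ?_ (h1.trans (Nat.le_mul_of_pos_right _ hm.pos))
    refine Nat.card_le_card_of_injective
      (fun a => ⟨((a : P) : G), ?_⟩) ?_
    · rcases a with ⟨a, ha⟩
      obtain ⟨j, hj⟩ := P.isPGroup' a
      have h2 : orderOf a ∣ 2 ^ k * m := orderOf_dvd_of_pow_eq_one ha
      have h3 : orderOf a ∣ 2 ^ j := orderOf_dvd_of_pow_eq_one hj
      have h4 : Nat.Coprime (orderOf a) m :=
        Nat.Coprime.coprime_dvd_left h3 (Nat.Coprime.pow_left j (Nat.coprime_two_left.mpr hm))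
      have h5 : a ^ (2 ^ k) = 1 := orderOf_dvd_iff_pow_eq_one.mp (h4.dvd_of_dvd_mul_right h2)
      change (a : G) ^ (2 ^ k) = 1
      rw [← Subgroup.coe_pow, h5]; rfl
    · intro a b hab
      apply Subtype.ext
      apply Subtype.ext
      simpa using hab
  · by_contra hne
    rw [not_nontrivial_iff_subsingleton] at hne
    have h1 : Nat.card P = 1 := by
      rw [Nat.card_eq_one_iff_unique]; exact ⟨hne, ⟨1⟩⟩
    have h2 : 2 ∣ Nat.card G := by
      have : orderOf t = 2 := orderOf_eq_prime ht ht1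
      rw [← this]; exact orderOf_dvd_natCard t
    have h3 : 2 ∣ Nat.card P := P.dvd_card_of_dvd_card h2
    omega

end LdProof

namespace LdProof

theorem field_aux1 {F : Type} [Field F] [Fintype F] (l : ℕ) [Fact l.Prime] [CharP F l]
    (hl : l % 8 = 3 ∨ l % 8 = 5) (z : F) (hz : z ^ 4 = -1) :
    (1 + z - z ^ 3) ^ (l + 1) = -1 := by
  have h8 : z ^ 8 = 1 := by
    rw [show 8 = 4 * 2 by norm_num, pow_mul, hz]; norm_num
  have hf : (1 + z - z ^ 3) ^ l = 1 - z + z ^ 3 := by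
    rw [sub_pow_char, add_pow_char, one_pow, ← pow_mul]
    have hd := Nat.div_add_mod l 8
    rcases hl with h | h
    · rw [h] at hd
      rw [← hd, show 3 * (8 * (l / 8) + 3) = 8 * (3 * (l / 8)) + 9 by ring, pow_add, pow_add,
        pow_mul, pow_mul z 8 (3 * (l / 8)), h8]
      linear_combination -(z^5 - z) * hz
    · rw [h] at hd
      rw [← hd, show 3 * (8 * (l / 8) + 5) = 8 * (3 * (l / 8)) + 15 by ring, pow_add, pow_add,
        pow_mul, pow_mul z 8 (3 * (l / 8)), h8]
      linear_combination (-z^11 + z^7 - z^3 + z) * hz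
  rw [pow_succ, hf]
  linear_combination (-z^2 + 2) * hz

theorem sq_pow_half {F : Type} [Field F] [Fintype F] (w : F) (hw : w ≠ 0) (hs : IsSquare w) (n : ℕ)
    (hn : Fintype.card F = 2 * n + 1) : w ^ n = 1 := by
  obtain ⟨y, rfl⟩ := hs
  have hy : y ≠ 0 := by rintro rfl; simp at hw
  have := FiniteField.pow_card_sub_one_eq_one y hy
  rw [hn, Nat.add_sub_cancel, pow_mul] at this
  rwa [← sq]

theorem field_aux3 {F : Type} [Field F] [Fintype F] (l : ℕ) [Fact l.Prime] [CharP F l]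
    (hl : l % 8 = 3) (hc : Fintype.card F = l ^ 2) (z : F) (hz : z ^ 4 = -1) :
    ¬ IsSquare (1 + z - z ^ 3) := by
  intro hs
  have h2 : (-1 : F) ≠ 1 := by
    apply Ring.neg_one_ne_one_of_char_ne_two
    rw [ringChar.eq F l]; rintro rfl; omega
  have h1 := field_aux1 l (Or.inl hl) z hz
  have h0 : (1 + z - z ^ 3) ≠ 0 := by
    intro h; rw [h] at h1; simp at h1
  obtain ⟨k, hk⟩ : ∃ k, l = 8 * k + 3 := ⟨l / 8, by omega⟩
  have h3 := sq_pow_half _ h0 hs ((l + 1) * (4 * k + 1)) (by rw [hc, hk]; ring)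
  rw [pow_mul, h1, Odd.neg_one_pow ⟨2 * k, by ring⟩] at h3
  exact h2 h3

theorem field_aux5 {F : Type} [Field F] [Fintype F] (l : ℕ) [Fact l.Prime] [CharP F l]
    (hl : l % 8 = 5) (hc : Fintype.card F = l ^ 2) (z : F) (hz : z ^ 4 = -1) :
    ¬ IsSquare z ∧ ¬ IsSquare (z * (1 + z - z ^ 3)) := by
  have h2 : (-1 : F) ≠ 1 := by
    apply Ring.neg_one_ne_one_of_char_ne_two
    rw [ringChar.eq F l]; rintro rfl; omega
  have h1 := field_aux1 l (Or.inr hl) z hz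
  have h0 : (1 + z - z ^ 3) ≠ 0 := by
    intro h; rw [h] at h1; simp at h1
  have hz0 : z ≠ 0 := by rintro rfl; simp at hz
  obtain ⟨k, hk⟩ : ∃ k, l = 8 * k + 5 := ⟨l / 8, by omega⟩
  have h4 : z ^ ((l + 1) * (4 * k + 2)) = -1 := by
    rw [hk, show (8 * k + 5 + 1) * (4 * k + 2) = 4 * (2 * (4 * k ^ 2 + 5 * k + 1) + 1) by ring,
      pow_mul, hz, Odd.neg_one_pow ⟨_, rfl⟩]
  constructor
  · intro hs
    have h3 := sq_pow_half _ hz0 hs ((l + 1) * (4 * k + 2)) (by rw [hc, hk]; ring)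
    exact h2 (h4 ▸ h3)
  · intro hs
    have h3 := sq_pow_half _ (mul_ne_zero hz0 h0) hs ((l + 1) * (4 * k + 2)) (by rw [hc, hk]; ring)
    rw [mul_pow, h4, pow_mul, h1, Even.neg_one_pow ⟨2 * k + 1, by ring⟩] at h3
    exact h2 (by simpa using h3)

section
variable (K : Type) [Field K] [NumberField K] [hK : IsCyclotomicExtension {8} ℚ K]

theorem order_aux (l : ℕ) (hl : l % 8 = 3 ∨ l % 8 = 5) : orderOf (l : ZMod 8) = 2 := by
  have : Fact (Nat.Prime 2) := ⟨Nat.prime_two⟩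
  have h : (l : ZMod 8) = ((l % 8 : ℕ) : ZMod 8) := by simp
  apply orderOf_eq_prime
  · rw [h]; rcases hl with h | h <;> rw [h] <;> decide
  · rw [h]; rcases hl with h | h <;> rw [h] <;> decide

theorem absNorm_aux (l : ℕ) [hp : Fact l.Prime] (hl : l % 8 = 3 ∨ l % 8 = 5) (P : Ideal (𝓞 K))
    [P.IsPrime] [P.LiesOver (Ideal.span {(l : ℤ)})] : Ideal.absNorm P = l ^ 2 := by
  have hnd : ¬ l ∣ 8 := by
    intro h
    have : l ∣ 2 := hp.out.dvd_of_dvd_pow (n := 3) h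
    have := Nat.le_of_dvd (by norm_num) this
    omega
  have h1 := IsCyclotomicExtension.Rat.inertiaDeg_eq_of_not_dvd l K P (m := 8) hnd
  rw [order_aux l hl] at h1
  have hm : (Ideal.span {(l : ℤ)}).IsMaximal :=
    (Nat.prime_iff_prime_int.mp hp.out).isMaximal_span_singleton
  have : P.IsMaximal := Ideal.IsMaximal.of_liesOver_isMaximal P (Ideal.span {(l : ℤ)})
  have := Ideal.natAbs_pow_inertiaDeg (l : ℤ) P
  rw [h1] at this
  simpa using this.symm

theorem primes_aux (l : ℕ) [hp : Fact l.Prime] (hl : l % 8 = 3 ∨ l % 8 = 5) :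
    ∃ a b : 𝓞 K, Prime a ∧ Prime b ∧ ¬ Associated a b ∧ (l : 𝓞 K) = a * b := by
  have hpid := pid8 K
  have : IsGalois ℚ K := IsCyclotomicExtension.isGalois {8} ℚ K
  have hnd : ¬ l ∣ 8 := by
    intro h
    have : l ∣ 2 := hp.out.dvd_of_dvd_pow (n := 3) h
    have := Nat.le_of_dvd (by norm_num) this
    omega
  have hl0 : (l : ℤ) ≠ 0 := by exact_mod_cast hp.out.ne_zero
  have hlp : Prime (l : ℤ) := Nat.prime_iff_prime_int.mp hp.out
  have hm : (Ideal.span {(l : ℤ)}).IsMaximal := hlp.isMaximal_span_singleton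
  have h1 := Ideal.ncard_primesOver_mul_ramificationIdxIn_mul_inertiaDegIn
    (Ideal.span {(l : ℤ)}) (𝓞 K) Gal(K/ℚ)
  have hfin : Module.finrank ℚ K = 4 := by
    rw [IsCyclotomicExtension.finrank (n := 8) K
      (Polynomial.cyclotomic.irreducible_rat (by norm_num))]; decide
  rw [IsCyclotomicExtension.Rat.ramificationIdxIn_eq_of_not_dvd l K (m := 8) hnd,
    IsCyclotomicExtension.Rat.inertiaDegIn_eq_of_not_dvd l K (m := 8) hnd,
    order_aux l hl, IsGaloisGroup.card_eq_finrank Gal(K/ℚ) ℚ K, hfin] at h1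
  have h2 : (Ideal.primesOver (Ideal.span {(l : ℤ)}) (𝓞 K)).ncard = 2 := by omega
  obtain ⟨P, Q, hPQ, hs⟩ := Set.ncard_eq_two.mp h2
  have key : ∀ P ∈ Ideal.primesOver (Ideal.span {(l : ℤ)}) (𝓞 K), ∃ a : 𝓞 K, Prime a ∧
      P = Ideal.span {a} ∧ a ∣ (l : 𝓞 K) ∧ Ideal.absNorm P = l ^ 2 := by
    rintro P ⟨hP1, hP2⟩
    obtain ⟨a, ha⟩ := (IsPrincipalIdealRing.principal P).1
    have ha : P = Ideal.span {a} := ha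
    have hnorm := absNorm_aux K l hl P
    have hP0 : P ≠ ⊥ := by
      rintro rfl
      rw [Ideal.absNorm_bot] at hnorm
      have := hp.out.pos
      have : 0 < l ^ 2 := by positivity
      omega
    have ha0 : a ≠ 0 := by
      rintro rfl; apply hP0; rw [ha]; simp
    refine ⟨a, ?_, ha, ?_, hnorm⟩
    · rw [← Ideal.span_singleton_prime ha0, ← ha]; exact hP1
    · rw [← Ideal.mem_span_singleton, ← ha]
      have : (l : ℤ) ∈ Ideal.span {(l : ℤ)} := Ideal.mem_span_singleton_self _
      rw [hP2.over, Ideal.under_def, Ideal.mem_comap] at this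
      simpa using this
  obtain ⟨a, ha, hPa, hal, hna⟩ := key P (by rw [hs]; simp)
  obtain ⟨b, hb, hQb, hbl, hnb⟩ := key Q (by rw [hs]; simp)
  have hab : ¬ Associated a b := by
    intro h
    apply hPQ
    rw [hPa, hQb]
    exact Ideal.span_singleton_eq_span_singleton.mpr h
  have habl : a * b ∣ (l : 𝓞 K) := by
    obtain ⟨c, hc⟩ := hal
    rw [hc] at hbl ⊢
    apply mul_dvd_mul_left
    apply (hb.dvd_or_dvd hbl).resolve_left
    intro h
    exact hab (hb.associated_of_dvd ha h).symm
  obtain ⟨c, hc⟩ := habl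
  have hcu : IsUnit c := by
    rw [← Ideal.span_singleton_eq_top, ← Ideal.absNorm_eq_one_iff]
    have e1 : Ideal.absNorm (Ideal.span {(l : 𝓞 K)}) = l ^ 4 := by
      rw [Ideal.absNorm_span_singleton]
      have : (l : 𝓞 K) = algebraMap ℤ (𝓞 K) (l : ℤ) := by simp
      rw [this, Algebra.norm_algebraMap, NumberField.RingOfIntegers.rank, hfin]
      simp [Int.natAbs_pow]
    rw [hc, ← Ideal.span_singleton_mul_span_singleton, ← Ideal.span_singleton_mul_span_singleton,
      map_mul, map_mul, ← hPa, ← hQb, hna, hnb] at e1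
    have : 0 < l ^ 4 := pow_pos hp.out.pos 4
    have e2 : l ^ 4 * Ideal.absNorm (Ideal.span {c}) = l ^ 4 * 1 := by
      rw [mul_one]
      calc _ = l ^ 2 * l ^ 2 * Ideal.absNorm (Ideal.span {c}) := by ring
        _ = l ^ 4 := e1
    exact Nat.eq_of_mul_eq_mul_left this e2
  obtain ⟨u, rfl⟩ := hcu
  refine ⟨a, b * u, ha, ?_, ?_, by rw [hc]; ring⟩
  · exact (associated_mul_unit_right b u u.isUnit).prime hb
  · intro h
    exact hab (h.trans (associated_mul_unit_right b u u.isUnit).symm)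

theorem quot_aux (l : ℕ) [hp : Fact l.Prime] (hl : l % 8 = 3 ∨ l % 8 = 5) (a : 𝓞 K) (ha : Prime a)
    (hal : a ∣ (l : 𝓞 K)) : (Ideal.span {a}).IsMaximal ∧ Nat.card (𝓞 K ⧸ Ideal.span {a}) = l ^ 2 ∧
      CharP (𝓞 K ⧸ Ideal.span {a}) l := by
  have hpid := pid8 K
  have hP : (Ideal.span {a}).IsPrime := (Ideal.span_singleton_prime ha.ne_zero).mpr ha
  have hmax : (Ideal.span {a}).IsMaximal := hP.isMaximal (by simpa using ha.ne_zero)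
  have hlp : Prime (l : ℤ) := Nat.prime_iff_prime_int.mp hp.out
  have hm : (Ideal.span {(l : ℤ)}).IsMaximal := hlp.isMaximal_span_singleton
  have hlo : (Ideal.span {a}).LiesOver (Ideal.span {(l : ℤ)}) := by
    constructor
    apply hm.eq_of_le
    · exact (hP.under ℤ).ne_top
    · rw [Ideal.span_singleton_le_iff_mem, Ideal.under_def, Ideal.mem_comap, Ideal.mem_span_singleton]
      simpa using hal
  refine ⟨hmax, ?_, ?_⟩
  · have := absNorm_aux K l hl (Ideal.span {a})
    rwa [Ideal.absNorm_apply, Submodule.cardQuot_apply] at this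
  · have : Nontrivial (𝓞 K ⧸ Ideal.span {a}) := Ideal.Quotient.nontrivial_iff.mpr hmax.ne_top
    rw [CharP.charP_iff_prime_eq_zero hp.out]
    have : ((l : ℕ) : 𝓞 K ⧸ Ideal.span {a}) = Ideal.Quotient.mk (Ideal.span {a}) (l : 𝓞 K) := by simp
    rw [this, Ideal.Quotient.eq_zero_iff_dvd]; exact hal

theorem nonsq3 (l : ℕ) [hp : Fact l.Prime] (hl : l % 8 = 3) (a : 𝓞 K) (ha : Prime a)
    (hal : a ∣ (l : 𝓞 K)) (z : 𝓞 K) (hz : z ^ 4 = -1) (x y : 𝓞 K) (hy : ¬ a ∣ y)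
    (h : a ∣ x ^ 2 - (1 + z - z ^ 3) * y ^ 2) : False := by
  obtain ⟨hm, hc, hch⟩ := quot_aux K l (Or.inl hl) a ha hal
  letI : Field (𝓞 K ⧸ Ideal.span {a}) := Ideal.Quotient.field _
  have : Finite (𝓞 K ⧸ Ideal.span {a}) := Nat.finite_of_card_ne_zero
    (by rw [hc]; exact pow_ne_zero _ hp.out.ne_zero)
  letI := Fintype.ofFinite (𝓞 K ⧸ Ideal.span {a})
  let f := Ideal.Quotient.mk (Ideal.span {a})
  have hfz : f z ^ 4 = -1 := by rw [← map_pow, hz]; simp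
  apply field_aux3 l hl (by rw [← hc, Nat.card_eq_fintype_card]) (f z) hfz
  have hfy : f y ≠ 0 := by
    intro h0; exact hy (Ideal.Quotient.eq_zero_iff_dvd a y |>.mp h0)
  have h0 : f (x ^ 2 - (1 + z - z ^ 3) * y ^ 2) = 0 := (Ideal.Quotient.eq_zero_iff_dvd _ _).mpr h
  simp only [map_sub, map_mul, map_add, map_one, map_pow] at h0
  refine ⟨f x / f y, ?_⟩
  field_simp
  linear_combination -h0

theorem nonsq5 (l : ℕ) [hp : Fact l.Prime] (hl : l % 8 = 5) (a : 𝓞 K) (ha : Prime a)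
    (hal : a ∣ (l : 𝓞 K)) (z : 𝓞 K) (hz : z ^ 4 = -1) (x y : 𝓞 K) (hy : ¬ a ∣ y)
    (h : a ∣ x ^ 2 - z * y ^ 2 ∨ a ∣ x ^ 2 - (z * (1 + z - z ^ 3)) * y ^ 2) : False := by
  obtain ⟨hm, hc, hch⟩ := quot_aux K l (Or.inr hl) a ha hal
  letI : Field (𝓞 K ⧸ Ideal.span {a}) := Ideal.Quotient.field _
  have : Finite (𝓞 K ⧸ Ideal.span {a}) := Nat.finite_of_card_ne_zero
    (by rw [hc]; exact pow_ne_zero _ hp.out.ne_zero)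
  letI := Fintype.ofFinite (𝓞 K ⧸ Ideal.span {a})
  let f := Ideal.Quotient.mk (Ideal.span {a})
  have hfz : f z ^ 4 = -1 := by rw [← map_pow, hz]; simp
  obtain ⟨h1, h2⟩ := field_aux5 l hl (by rw [← hc, Nat.card_eq_fintype_card]) (f z) hfz
  have hfy : f y ≠ 0 := by
    intro h0; exact hy (Ideal.Quotient.eq_zero_iff_dvd a y |>.mp h0)
  rcases h with h | h
  · have h0 : f (x ^ 2 - z * y ^ 2) = 0 := (Ideal.Quotient.eq_zero_iff_dvd _ _).mpr h
    simp only [map_sub, map_mul, map_pow] at h0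
    apply h1
    refine ⟨f x / f y, ?_⟩
    field_simp
    linear_combination -h0
  · have h0 : f (x ^ 2 - (z * (1 + z - z ^ 3)) * y ^ 2) = 0 :=
      (Ideal.Quotient.eq_zero_iff_dvd _ _).mpr h
    simp only [map_sub, map_mul, map_add, map_one, map_pow] at h0
    apply h2
    refine ⟨f x / f y, ?_⟩
    field_simp
    linear_combination -h0

end
end LdProof

namespace LdProof

/-- A quadratic extension `L = K(s)`, `s ^ 2 = d`, with conjugation `σ`. -/
structure Quad (K L : Type) [Field K] [NumberField K] [Field L] [NumberField L] [Algebra K L]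
    (d : 𝓞 K) (s : L) (σ : L ≃ₐ[K] L) : Prop where
  ssq : s ^ 2 = algebraMap K L d
  conj : σ s = -s
  s0 : s ≠ 0
  rep : ∀ x : L, ∃ a b : K, x = algebraMap K L a + algebraMap K L b * s

section
set_option linter.unusedSectionVars false
variable {K L : Type} [Field K] [NumberField K] [Field L] [NumberField L] [Algebra K L]
    {d : 𝓞 K} {s : L} {σ : L ≃ₐ[K] L}

theorem Quad.invol (h : Quad K L d s σ) (x : L) : σ (σ x) = x := by
  obtain ⟨a, b, rfl⟩ := h.rep x
  simp [h.conj]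

theorem Quad.fixed (h : Quad K L d s σ) (x : L) (hx : σ x = x) : ∃ a : K, x = algebraMap K L a := by
  obtain ⟨a, b, rfl⟩ := h.rep x
  simp [h.conj] at hx
  have h2 : (2 : L) * (algebraMap K L b * s) = 0 := by linear_combination -hx
  have h3 : algebraMap K L b * s = 0 := by
    rcases mul_eq_zero.mp h2 with h | h
    · norm_num at h
    · exact h
  exact ⟨a, by rw [h3, add_zero]⟩

theorem int_down {a : K} (ha : IsIntegral ℤ (algebraMap K L a)) : ∃ b : 𝓞 K, (b : K) = a := by
  have : IsIntegral ℤ a := by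
    rwa [isIntegral_algebraMap_iff (algebraMap K L).injective] at ha
  exact ⟨⟨a, this⟩, rfl⟩

theorem int_up (a : 𝓞 K) : IsIntegral ℤ (algebraMap K L a) :=
  (RingOfIntegers.isIntegral_coe a).algebraMap

theorem Quad.fixint (h : Quad K L d s σ) (x : L) (hx : σ x = x) (hi : IsIntegral ℤ x) :
    ∃ a : 𝓞 K, x = algebraMap K L a := by
  obtain ⟨a, rfl⟩ := h.fixed x hx
  obtain ⟨b, rfl⟩ := int_down hi
  exact ⟨b, rfl⟩

theorem Quad.int_conj (x : L) (hi : IsIntegral ℤ x) : IsIntegral ℤ (σ x) :=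
  hi.map (σ : L →+* L).toIntAlgHom

theorem Quad.hilbert90 (h : Quad K L d s σ) (m : L) (hm : m * σ m = 1) :
    ∃ β : L, β ≠ 0 ∧ m = β / σ β := by
  by_cases h1 : m = -1
  · refine ⟨s, h.s0, ?_⟩
    rw [h.conj, h1]
    have := h.s0
    field_simp
  · have h2 : 1 + m ≠ 0 := fun h0 => h1 (by linear_combination h0)
    have h3 : σ (1 + m) ≠ 0 := (map_ne_zero σ).mpr h2
    refine ⟨1 + m, h2, ?_⟩
    rw [eq_div_iff h3, map_add, map_one]
    linear_combination hm

theorem descent {R : Type} [CommRing R] [IsDomain R] (π d u : R) (hπ : Prime π) (hd : π ∣ d)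
    (hd2 : ¬ π ^ 2 ∣ d) (n : ℕ) : ∀ A B C : R, A ^ 2 - d * B ^ 2 = u * C ^ 2 → ¬ π ^ n ∣ C →
    ∃ A C : R, ¬ π ∣ C ∧ π ∣ A ^ 2 - u * C ^ 2 := by
  obtain ⟨d', rfl⟩ := hd
  have hd' : ¬ π ∣ d' := fun ⟨e, he⟩ => hd2 ⟨e, by rw [he]; ring⟩
  have hπ0 := hπ.ne_zero
  induction n with
  | zero => intro A B C _ h; simp at h
  | succ n ih =>
    intro A B C h hn
    by_cases hC : π ∣ C
    · obtain ⟨C', rfl⟩ := hC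
      have hA : π ∣ A := by
        apply hπ.dvd_of_dvd_pow (n := 2)
        exact ⟨d' * B ^ 2 + u * π * C' ^ 2, by linear_combination h⟩
      obtain ⟨A', rfl⟩ := hA
      have hB : π ∣ B := by
        have : π ∣ d' * B ^ 2 := by
          refine ⟨A' ^ 2 - u * C' ^ 2, ?_⟩
          apply mul_left_cancel₀ hπ0
          linear_combination -h
        exact hπ.dvd_of_dvd_pow ((hπ.dvd_or_dvd this).resolve_left hd')
      obtain ⟨B', rfl⟩ := hB
      refine ih A' B' C' ?_ ?_
      · apply mul_left_cancel₀ (pow_ne_zero 2 hπ0)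
        linear_combination h
      · intro h'
        apply hn
        rw [pow_succ']
        exact mul_dvd_mul_left π h'
    · exact ⟨A, C, hC, d' * B ^ 2, by linear_combination h⟩

theorem Quad.nonnorm (h : Quad K L d s σ) (π u : 𝓞 K) (hπ : Prime π) (hd : π ∣ d)
    (hd2 : ¬ π ^ 2 ∣ d) (x : L) (hx : x * σ x = algebraMap K L u) :
    ∃ A C : 𝓞 K, ¬ π ∣ C ∧ π ∣ A ^ 2 - u * C ^ 2 := by
  obtain ⟨a, b, rfl⟩ := h.rep x
  simp only [map_add, map_mul, AlgEquiv.commutes, h.conj] at hx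
  have h1 : a ^ 2 - d * b ^ 2 = u := by
    apply (algebraMap K L).injective
    simp only [map_sub, map_mul, map_pow]
    linear_combination hx + (algebraMap K L b) ^ 2 * h.ssq
  obtain ⟨A, C, hC, rfl⟩ := IsFractionRing.div_surjective (A := 𝓞 K) a
  obtain ⟨B, D, hD, rfl⟩ := IsFractionRing.div_surjective (A := 𝓞 K) b
  have hC0 := nonZeroDivisors.ne_zero hC
  have hD0 := nonZeroDivisors.ne_zero hD
  have hC0' : (C : K) ≠ 0 := by simpa using hC0
  have hD0' : (D : K) ≠ 0 := by simpa using hD0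
  have h2 : (A * D) ^ 2 - d * (B * C) ^ 2 = u * (C * D) ^ 2 := by
    apply RingOfIntegers.coe_injective
    push_cast
    field_simp at h1
    linear_combination h1
  have hfm : FiniteMultiplicity π (C * D) :=
    FiniteMultiplicity.of_not_isUnit hπ.not_isUnit (mul_ne_zero hC0 hD0)
  obtain ⟨n, hn⟩ := hfm
  exact descent π d u hπ hd hd2 (n + 1) _ _ _ h2 hn

theorem rankK (K : Type) [Field K] [NumberField K] [IsCyclotomicExtension {8} ℚ K] :
    Units.rank K = 1 := by
  have htot : Nat.totient 8 = 4 := by decide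
  unfold Units.rank
  rw [InfinitePlace.card_eq_nrRealPlaces_add_nrComplexPlaces,
    IsCyclotomicExtension.Rat.nrComplexPlaces_eq_totient_div_two 8,
    IsCyclotomicExtension.Rat.nrRealPlaces_eq_zero (n := 8) K (by norm_num), htot]

theorem Quad.key [IsCyclotomicExtension {8} ℚ K] (h : Quad K L d s σ) (q p : ℕ) [Fact q.Prime]
    [Fact p.Prime] (hq8 : q % 8 = 3) (hp8 : p % 8 = 5) (π1 π3 : 𝓞 K) (h1 : Prime π1)
    (h3 : Prime π3) (h1q : π1 ∣ (q : 𝓞 K)) (h3p : π3 ∣ (p : 𝓞 K)) (h1d : π1 ∣ d) (h3d : π3 ∣ d)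
    (h1d2 : ¬ π1 ^ 2 ∣ d) (h3d2 : ¬ π3 ^ 2 ∣ d) (z : 𝓞 K) (hz : z ^ 4 = -1)
    (u : (𝓞 K)ˣ) (x : L) (hx : x * σ x = algebraMap K L u) : ∃ v : (𝓞 K)ˣ, u = v ^ 2 := by
  let N : Subgroup (𝓞 K)ˣ :=
    { carrier := {u | ∃ x : L, x * σ x = algebraMap K L (algebraMap (𝓞 K) K u)}
      one_mem' := ⟨1, by simp⟩
      mul_mem' := by
        rintro a b ⟨x, hx⟩ ⟨y, hy⟩
        refine ⟨x * y, ?_⟩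
        rw [Units.val_mul, map_mul, map_mul, map_mul, ← hx, ← hy]; ring
      inv_mem' := by
        rintro a ⟨x, hx⟩
        refine ⟨x⁻¹, ?_⟩
        rw [map_inv₀, ← mul_inv, hx, ← map_inv₀]
        simp }
  have hzu : IsUnit z := IsUnit.of_mul_eq_one (-z ^ 3) (by linear_combination -hz)
  have heu : IsUnit (1 + z - z ^ 3) :=
    IsUnit.of_mul_eq_one (-(1 - z + z ^ 3)) (by linear_combination (z ^ 2 - 2) * hz)
  obtain ⟨zu, rfl⟩ := hzu
  obtain ⟨eu, heu⟩ := heu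
  have n1 : zu ∉ N := by
    rintro ⟨x, hx⟩
    obtain ⟨A, C, hC, hAC⟩ := h.nonnorm π3 _ h3 h3d h3d2 x hx
    exact nonsq5 K p hp8 π3 h3 h3p _ hz A C hC (Or.inl hAC)
  have n2 : eu ∉ N := by
    rintro ⟨x, hx⟩
    obtain ⟨A, C, hC, hAC⟩ := h.nonnorm π1 _ h1 h1d h1d2 x hx
    rw [heu] at hAC
    exact nonsq3 K q hq8 π1 h1 h1q _ hz A C hC hAC
  have n3 : zu * eu ∉ N := by
    rintro ⟨x, hx⟩
    obtain ⟨A, C, hC, hAC⟩ := h.nonnorm π3 _ h3 h3d h3d2 x hx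
    push_cast at hAC
    rw [heu] at hAC
    exact nonsq5 K p hp8 π3 h3 h3p _ hz A C hC (Or.inr hAC)
  have hle : (powMonoidHom 2 : (𝓞 K)ˣ →* (𝓞 K)ˣ).range ≤ N := by
    rintro _ ⟨y, rfl⟩
    refine ⟨algebraMap K L y, ?_⟩
    simp; ring
  have hidx := unit_index K
  rw [rankK K] at hidx
  have hmul := Subgroup.relIndex_mul_index hle
  rw [hidx] at hmul
  have hu : u ∈ N := ⟨x, hx⟩
  have hd4 : N.index ∣ 4 := ⟨_, by rw [mul_comm, hmul]; norm_num⟩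
  have hi1 : N.index ≠ 1 := by
    intro h0
    rw [Subgroup.index_eq_one] at h0
    exact n1 (h0 ▸ Subgroup.mem_top _)
  have hi2 : N.index ≠ 2 := by
    intro h0
    exact n3 ((Subgroup.mul_mem_iff_of_index_two h0).mpr ⟨fun h => absurd h n1, fun h => absurd h n2⟩)
  have hi4 : N.index = 4 := by
    have := Nat.le_of_dvd (by norm_num) hd4
    interval_cases hh : N.index <;> omega
  rw [hi4] at hmul
  have : (powMonoidHom 2 : (𝓞 K)ˣ →* (𝓞 K)ˣ).range.relIndex N = 1 := by omega
  rw [Subgroup.relIndex_eq_one] at this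
  obtain ⟨v, hv⟩ := this hu
  exact ⟨v, hv.symm⟩

end
end LdProof

namespace LdProof
open scoped nonZeroDivisors

/-- The units of the ring of integers, inside the multiplicative group of the field. -/
def unitsIn (F : Type) [Field F] : Subgroup Fˣ :=
  (Units.map (algebraMap (𝓞 F) F : 𝓞 F →* F)).range

theorem mem_unitsIn (F : Type) [Field F] (x : Fˣ) :
    x ∈ unitsIn F ↔ IsIntegral ℤ (x : F) ∧ IsIntegral ℤ ((x : F)⁻¹) := by
  constructor
  · rintro ⟨u, rfl⟩
    constructor
    · exact RingOfIntegers.isIntegral_coe (u : 𝓞 F)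
    · rw [← Units.val_inv_eq_inv_val, ← map_inv]
      exact RingOfIntegers.isIntegral_coe ((u⁻¹ : (𝓞 F)ˣ) : 𝓞 F)
  · rintro ⟨h1, h2⟩
    refine ⟨⟨⟨x, h1⟩, ⟨(x : F)⁻¹, h2⟩, ?_, ?_⟩, ?_⟩
    · apply RingOfIntegers.coe_injective
      change (x : F) * (x : F)⁻¹ = 1
      simp
    · apply RingOfIntegers.coe_injective
      change (x : F)⁻¹ * (x : F) = 1
      simp
    · ext; rfl

theorem sq_unitsIn (F : Type) [Field F] [NumberField F] :
    ((unitsIn F).map (powMonoidHom 2)).relIndex (unitsIn F) = 2 ^ (Units.rank F + 1) := by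
  have hinj : Function.Injective (Units.map (algebraMap (𝓞 F) F : 𝓞 F →* F)) :=
    Units.map_injective RingOfIntegers.coe_injective
  rw [unitsIn, MonoidHom.range_eq_map, Subgroup.map_map]
  have : (powMonoidHom 2 : Fˣ →* Fˣ).comp (Units.map (algebraMap (𝓞 F) F : 𝓞 F →* F)) =
    (Units.map (algebraMap (𝓞 F) F : 𝓞 F →* F)).comp (powMonoidHom 2) := by
    ext x; simp
  rw [this, ← Subgroup.map_map, Subgroup.relIndex_map_map_of_injective _ _ hinj,
    Subgroup.relIndex_top_right, ← MonoidHom.range_eq_map, unit_index]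

theorem sq_map_rel {X Y : Type} [CommGroup X] [CommGroup Y] (f : X →* Y)
    (hf : Function.Injective f) (A : Subgroup X) :
    ((A.map f).map (powMonoidHom 2)).relIndex (A.map f) = (A.map (powMonoidHom 2)).relIndex A := by
  rw [Subgroup.map_map]
  have : (powMonoidHom 2 : Y →* Y).comp f = f.comp (powMonoidHom 2) := by
    ext x; simp
  rw [this, ← Subgroup.map_map, Subgroup.relIndex_map_map_of_injective _ _ hf]

theorem prin_eq_one (F : Type) [Field F] [NumberField F] (x : Fˣ) :
    toPrincipalIdeal (𝓞 F) F x = 1 ↔ x ∈ unitsIn F := by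
  have h1 : ∀ x : F, x ∈ (1 : FractionalIdeal (𝓞 F)⁰ F) ↔ IsIntegral ℤ x := by
    intro x
    rw [FractionalIdeal.mem_one_iff]
    constructor
    · rintro ⟨y, rfl⟩; exact RingOfIntegers.isIntegral_coe y
    · intro h; exact ⟨⟨x, h⟩, rfl⟩
  have h2 : ∀ x : Fˣ, toPrincipalIdeal (𝓞 F) F x = 1 → IsIntegral ℤ (x : F) := by
    intro x hx
    rw [toPrincipalIdeal_eq_iff] at hx
    rw [← h1, ← Units.val_one, ← hx]
    exact FractionalIdeal.mem_spanSingleton_self _ _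
  rw [mem_unitsIn]
  constructor
  · intro hx
    refine ⟨h2 x hx, ?_⟩
    rw [← Units.val_inv_eq_inv_val]
    apply h2
    rw [map_inv, hx, inv_one]
  · rintro ⟨ha, hb⟩
    rw [toPrincipalIdeal_eq_iff]
    apply le_antisymm
    · rw [FractionalIdeal.spanSingleton_le_iff_mem, Units.val_one, h1]; exact ha
    · rw [Units.val_one, ← FractionalIdeal.spanSingleton_one, FractionalIdeal.spanSingleton_le_iff_mem,
        FractionalIdeal.mem_spanSingleton]
      refine ⟨⟨(x : F)⁻¹, hb⟩, ?_⟩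
      change (x : F)⁻¹ * x = 1
      simp

section
set_option linter.unusedSectionVars false
variable {K L : Type} [Field K] [NumberField K] [Field L] [NumberField L] [Algebra K L]
    {d : 𝓞 K} {s : L} {σ : L ≃ₐ[K] L}

/-- The inclusion of multiplicative groups. -/
def kL (K L : Type) [Field K] [Field L] [Algebra K L] : Kˣ →* Lˣ :=
  Units.map (algebraMap K L : K →* L)

theorem kL_inj : Function.Injective (kL K L) := Units.map_injective (algebraMap K L).injective

@[simp] theorem kL_coe (x : Kˣ) : (kL K L x : L) = algebraMap K L x := rfl

theorem kL_unit (x : Kˣ) : kL K L x ∈ unitsIn L ↔ x ∈ unitsIn K := by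
  rw [mem_unitsIn, mem_unitsIn, kL_coe, ← map_inv₀,
    isIntegral_algebraMap_iff (algebraMap K L).injective,
    isIntegral_algebraMap_iff (algebraMap K L).injective]

/-- The conjugation on the multiplicative group. -/
def sg (σ : L ≃ₐ[K] L) : Lˣ →* Lˣ := Units.map (σ : L →* L)

@[simp] theorem sg_coe (x : Lˣ) : (sg σ x : L) = σ x := rfl

@[simp] theorem sg_kL (x : Kˣ) : sg σ (kL K L x) = kL K L x := by
  ext; simp

theorem sg_unit (x : Lˣ) (h : x ∈ unitsIn L) : sg σ x ∈ unitsIn L := by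
  rw [mem_unitsIn] at *
  refine ⟨Quad.int_conj _ h.1, ?_⟩
  rw [sg_coe, ← map_inv₀]
  exact Quad.int_conj _ h.2

theorem Quad.sg_sg (h : Quad K L d s σ) (x : Lˣ) : sg σ (sg σ x) = x := by
  ext; simp [h.invol]

theorem Quad.sg_fixed (h : Quad K L d s σ) (x : Lˣ) (hx : sg σ x = x) : ∃ a : Kˣ, x = kL K L a := by
  obtain ⟨a, ha⟩ := h.fixed x (congrArg Units.val hx)
  have : a ≠ 0 := by rintro rfl; simp at ha
  exact ⟨Units.mk0 a this, by ext; simpa using ha⟩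

theorem Quad.sg_norm (h : Quad K L d s σ) (x : Lˣ) : ∃ a : Kˣ, x * sg σ x = kL K L a := by
  apply h.sg_fixed
  rw [map_mul, h.sg_sg, mul_comm]

theorem Quad.sg_hilbert (h : Quad K L d s σ) (m : Lˣ) (hm : m * sg σ m = 1) :
    ∃ b : Lˣ, m = b / sg σ b := by
  obtain ⟨β, h0, h1⟩ := h.hilbert90 m (by simpa using congrArg Units.val hm)
  exact ⟨Units.mk0 β h0, by ext; simpa using h1⟩

/-- The units of relative norm one. -/
def Mgrp (σ : L ≃ₐ[K] L) : Subgroup Lˣ :=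
  unitsIn L ⊓ (MonoidHom.id Lˣ * sg σ).ker

theorem mem_Mgrp (x : Lˣ) : x ∈ Mgrp σ ↔ x ∈ unitsIn L ∧ x * sg σ x = 1 := Iff.rfl

/-- The norm property used everywhere below. -/
def KeyProp (σ : L ≃ₐ[K] L) : Prop :=
  ∀ (x : Lˣ) (u : Kˣ), u ∈ unitsIn K → x * sg σ x = kL K L u → ∃ v ∈ unitsIn K, u = v ^ 2

theorem Quad.M_rel (h : Quad K L d s σ) (hkey : KeyProp σ) (i : Kˣ) (hi : i ^ 2 = -1)
    (hrK : Units.rank K = 1) (hrL : Units.rank L = 3) :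
    ((Mgrp σ).map (powMonoidHom 2)).relIndex (Mgrp σ) = 8 := by
  have hiu : i ∈ unitsIn K := by
    have i1 : IsIntegral ℤ (i : K) := by
      have e : (i : K) ^ 2 = -1 := by rw [← Units.val_pow_eq_pow_val, hi]; simp
      exact IsIntegral.of_pow (n := 2) (by norm_num) (by rw [e]; exact isIntegral_one.neg)
    rw [mem_unitsIn]
    refine ⟨i1, ?_⟩
    have : ((i : K))⁻¹ = -i := by
      have e : (i : K) ^ 2 = -1 := by rw [← Units.val_pow_eq_pow_val, hi]; simp
      have := i.ne_zero
      field_simp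
      rw [e]; ring
    rw [this]; exact i1.neg
  have h2 : (2 : L) ≠ 0 := by norm_num
  refine M_index (unitsIn L) ((unitsIn K).map (kL K L)) (Mgrp σ) (-1) ?_ ?_ ?_ ?_ ?_ ?_ ?_ ?_ ?_
  · apply le_antisymm
    · intro e he
      obtain ⟨a, ha⟩ := h.sg_norm e
      have hau : a ∈ unitsIn K := by
        rw [← kL_unit (L := L), ← ha]; exact mul_mem he (sg_unit e he)
      obtain ⟨v, hv, rfl⟩ := hkey e a hau ha
      have : e = e / kL K L v * kL K L v := by simp
      rw [this]
      apply Subgroup.mul_mem_sup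
      · rw [mem_Mgrp]
        refine ⟨div_mem he ((kL_unit v).mpr hv), ?_⟩
        rw [map_div, sg_kL, div_mul_div_comm, ha, map_pow, sq, div_self']
      · exact Subgroup.mem_map_of_mem _ hv
    · apply sup_le inf_le_left
      rintro _ ⟨v, hv, rfl⟩
      exact (kL_unit v).mpr hv
  · rintro x hx ⟨v, hv, rfl⟩
    have := ((mem_Mgrp _).mp hx).2
    rw [sg_kL, ← sq] at this
    have h3 := congrArg Units.val this
    rw [Units.val_pow_eq_pow_val, Units.val_one, sq_eq_one_iff] at h3
    rcases h3 with h3 | h3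
    · left; ext; simpa using h3
    · right; ext; simpa using h3
  · rw [mem_Mgrp, mem_unitsIn]
    refine ⟨⟨?_, ?_⟩, ?_⟩
    · simpa using isIntegral_one.neg
    · simpa using isIntegral_one.neg
    · ext; simp
  · refine ⟨-1, ?_, by ext; simp⟩
    rw [SetLike.mem_coe, mem_unitsIn]
    refine ⟨?_, ?_⟩
    · simpa using isIntegral_one.neg
    · simpa using isIntegral_one.neg
  · simp
  · intro m hm hm2
    have hm1 := ((mem_Mgrp _).mp hm).2
    have e1 : (m / kL K L i) ^ 2 = 1 := by
      rw [div_pow, hm2, ← map_pow, hi]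
      ext; simp
    have h3 := congrArg Units.val e1
    rw [Units.val_pow_eq_pow_val, Units.val_one, sq_eq_one_iff] at h3
    have h4 : sg σ m = m := by
      have : (m : L) = algebraMap K L i ∨ (m : L) = - algebraMap K L i := by
        have hi0 : algebraMap K L i ≠ 0 := by simp
        rw [Units.val_div_eq_div_val, kL_coe, div_eq_iff hi0, div_eq_iff hi0] at h3
        simpa using h3
      ext
      rcases this with h | h <;> rw [sg_coe, h] <;> simp
    rw [h4, ← sq, hm2] at hm1
    have := congrArg Units.val hm1
    simp only [Units.val_neg, Units.val_one] at this
    apply h2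
    linear_combination -this
  · rintro x hx ⟨a, ha, hax⟩
    have h3 : sg σ x ^ 2 = x ^ 2 := by
      rw [← map_pow, ← (hax : kL K L a = x ^ 2), sg_kL]
    have h4 := congrArg Units.val h3
    rw [Units.val_pow_eq_pow_val, Units.val_pow_eq_pow_val, sq_eq_sq_iff_eq_or_eq_neg] at h4
    rcases h4 with h4 | h4
    · obtain ⟨b, rfl⟩ := h.sg_fixed x (Units.ext h4)
      exact ⟨_, ⟨b, (kL_unit b).mp hx, rfl⟩, rfl⟩
    · have h5 : sg σ x = -x := Units.ext h4
      obtain ⟨v, hv, hv2⟩ := hkey x (-a) (by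
        rw [SetLike.mem_coe, mem_unitsIn] at ha
        rw [mem_unitsIn]
        simpa using ha) (by
        rw [h5, ← neg_mul_eq_mul_neg, ← sq, ← (hax : kL K L a = x ^ 2)]
        ext; simp)
      refine ⟨_, ⟨i * v, mul_mem hiu hv, rfl⟩, ?_⟩
      rw [← (hax : kL K L a = x ^ 2), ← map_pow, mul_pow, hi, ← hv2]
      simp
  · rw [sq_unitsIn, hrL]
    norm_num
  · rw [sq_map_rel _ kL_inj, sq_unitsIn, hrK]
    norm_num

end
end LdProof

namespace LdProof
open scoped nonZeroDivisors

section
set_option linter.unusedSectionVars false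
variable {K L : Type} [Field K] [NumberField K] [Field L] [NumberField L] [Algebra K L]
    {d : 𝓞 K} {s : L} {σ : L ≃ₐ[K] L}

theorem pow_unitsIn (x : Lˣ) (h : x ^ 2 ∈ unitsIn L) : x ∈ unitsIn L := by
  rw [mem_unitsIn] at *
  refine ⟨IsIntegral.of_pow (n := 2) (by norm_num) (by simpa using h.1),
    IsIntegral.of_pow (n := 2) (by norm_num) (by simpa using h.2)⟩

theorem prin_eq_iff (x y : Lˣ) :
    toPrincipalIdeal (𝓞 L) L x = toPrincipalIdeal (𝓞 L) L y ↔ x / y ∈ unitsIn L := by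
  rw [← prin_eq_one, map_div, div_eq_one]

/-- Principal ideals generated by elements of `K`. -/
noncomputable def PK (K L : Type) [Field K] [NumberField K] [Field L] [NumberField L]
    [Algebra K L] : Subgroup (FractionalIdeal (𝓞 L)⁰ L)ˣ :=
  ((toPrincipalIdeal (𝓞 L) L).comp (kL K L)).range

/-- Ideals whose square is generated by an element of `K`. -/
noncomputable def Agrp (K L : Type) [Field K] [NumberField K] [Field L] [NumberField L]
    [Algebra K L] : Subgroup (FractionalIdeal (𝓞 L)⁰ L)ˣ :=
  (PK K L).comap (powMonoidHom 2)

theorem mem_PK (I : (FractionalIdeal (𝓞 L)⁰ L)ˣ) :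
    I ∈ PK K L ↔ ∃ a : Kˣ, toPrincipalIdeal (𝓞 L) L (kL K L a) = I := Iff.rfl

theorem mem_Agrp (I : (FractionalIdeal (𝓞 L)⁰ L)ˣ) :
    I ∈ Agrp K L ↔ ∃ a : Kˣ, toPrincipalIdeal (𝓞 L) L (kL K L a) = I ^ 2 := Iff.rfl

theorem Quad.decomp (h : Quad K L d s σ) (hkey : KeyProp σ) (e : Lˣ) (he : e ∈ unitsIn L) :
    ∃ m ∈ Mgrp σ, ∃ v ∈ unitsIn K, e = m * kL K L v := by
  obtain ⟨a, ha⟩ := h.sg_norm e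
  have hau : a ∈ unitsIn K := by
    rw [← kL_unit (L := L), ← ha]; exact mul_mem he (sg_unit e he)
  obtain ⟨v, hv, rfl⟩ := hkey e a hau ha
  refine ⟨e / kL K L v, ?_, v, hv, by simp⟩
  rw [mem_Mgrp]
  refine ⟨div_mem he ((kL_unit v).mpr hv), ?_⟩
  rw [map_div, sg_kL, div_mul_div_comm, ha, map_pow, sq, div_self']

theorem Quad.N2 (h : Quad K L d s σ) (hkey : KeyProp σ)
    (hM : ((Mgrp σ).map (powMonoidHom 2)).relIndex (Mgrp σ) = 8) :
    (PK K L).relIndex ((toPrincipalIdeal (𝓞 L) L).range ⊓ Agrp K L) = 8 := by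
  let τ : Lˣ →* Lˣ := MonoidHom.id Lˣ / sg σ
  have hτ : ∀ x, τ x = x / sg σ x := fun x => rfl
  have hMs : ∀ m ∈ Mgrp σ, m / sg σ m = m ^ 2 := by
    intro m hm
    have := ((mem_Mgrp m).mp hm).2
    rw [← eq_inv_iff_mul_eq_one] at this
    nth_rewrite 1 [this]
    rw [div_eq_mul_inv, ← sq, eq_inv_of_mul_eq_one_right ((mem_Mgrp m).mp hm).2]
    simp
  have e1 : (Agrp K L).comap (toPrincipalIdeal (𝓞 L) L) = (Mgrp σ).comap τ := by
    ext b
    rw [Subgroup.mem_comap, Subgroup.mem_comap, mem_Agrp, mem_Mgrp, hτ]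
    constructor
    · rintro ⟨a, ha⟩
      rw [← map_pow, eq_comm, prin_eq_iff] at ha
      constructor
      · apply pow_unitsIn
        have : (b / sg σ b) ^ 2 = (b ^ 2 / kL K L a) / sg σ (b ^ 2 / kL K L a) := by
          rw [map_div, sg_kL, map_pow, div_div_div_cancel_right, div_pow]
        rw [this]
        exact div_mem ha (sg_unit _ ha)
      · rw [map_div, h.sg_sg]; simp
    · rintro ⟨h1, h2⟩
      obtain ⟨a, ha⟩ := h.sg_norm b
      refine ⟨a, ?_⟩
      rw [← map_pow, eq_comm, prin_eq_iff, ← ha]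
      rwa [sq, mul_div_mul_left_eq_div]
  have e2 : (PK K L).comap (toPrincipalIdeal (𝓞 L) L) = ((Mgrp σ).map (powMonoidHom 2)).comap τ := by
    ext b
    rw [Subgroup.mem_comap, Subgroup.mem_comap, mem_PK, hτ]
    constructor
    · rintro ⟨a, ha⟩
      rw [eq_comm, prin_eq_iff] at ha
      obtain ⟨m, hm, v, hv, hmv⟩ := h.decomp hkey _ ha
      refine ⟨m, hm, ?_⟩
      rw [powMonoidHom_apply, ← hMs m hm]
      rw [div_eq_iff_eq_mul] at hmv
      rw [hmv]
      simp only [map_mul, sg_kL, mul_div_mul_right_eq_div]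
    · rintro ⟨m, hm, hmb⟩
      rw [powMonoidHom_apply, ← hMs m hm] at hmb
      obtain ⟨a, ha⟩ := h.sg_fixed (b / m) (by
        rw [map_div, div_eq_div_iff_mul_eq_mul]
        rw [div_eq_div_iff_mul_eq_mul] at hmb
        rw [mul_comm, hmb])
      refine ⟨a, ?_⟩
      rw [eq_comm, prin_eq_iff, ← ha]
      simpa using ((mem_Mgrp m).mp hm).1
  rw [← Subgroup.map_comap_eq, ← Subgroup.relIndex_comap, e1, e2, Subgroup.relIndex_comap,
    Subgroup.map_comap_eq]
  have : τ.range ⊓ Mgrp σ = Mgrp σ := by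
    apply inf_eq_right.mpr
    intro m hm
    obtain ⟨b, hb⟩ := h.sg_hilbert m ((mem_Mgrp m).mp hm).2
    exact ⟨b, hb.symm⟩
  rw [this, hM]

end
end LdProof

namespace LdProof
open scoped nonZeroDivisors

section
set_option linter.unusedSectionVars false
variable {K L : Type} [Field K] [NumberField K] [Field L] [NumberField L] [Algebra K L]
    {d : 𝓞 K} {s : L} {σ : L ≃ₐ[K] L}

theorem mem_span_iff (r x : L) (hr : r ≠ 0) :
    x ∈ FractionalIdeal.spanSingleton (𝓞 L)⁰ r ↔ IsIntegral ℤ (x / r) := by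
  rw [FractionalIdeal.mem_spanSingleton]
  constructor
  · rintro ⟨z, rfl⟩
    rw [Algebra.smul_def, mul_div_cancel_right₀ _ hr]
    exact RingOfIntegers.isIntegral_coe z
  · intro h
    refine ⟨⟨x / r, h⟩, ?_⟩
    change x / r * r = x
    field_simp

theorem smul_mem_frac (I : FractionalIdeal (𝓞 L)⁰ L) (x y : L) (hx : x ∈ I) (hy : IsIntegral ℤ y) :
    y * x ∈ I := by
  have := I.val.smul_mem (⟨y, hy⟩ : 𝓞 L) hx
  exact this

theorem co_mul (a b : 𝓞 K) : algebraMap K L ((a * b : 𝓞 K) : K) = algebraMap K L a * algebraMap K L b :=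
  map_mul ((algebraMap K L).comp (algebraMap (𝓞 K) K)) a b

theorem co_add (a b : 𝓞 K) : algebraMap K L ((a + b : 𝓞 K) : K) = algebraMap K L a + algebraMap K L b :=
  map_add ((algebraMap K L).comp (algebraMap (𝓞 K) K)) a b

theorem co_one : algebraMap K L ((1 : 𝓞 K) : K) = 1 :=
  map_one ((algebraMap K L).comp (algebraMap (𝓞 K) K))

theorem co_inj {a b : 𝓞 K} (h : algebraMap K L (a : K) = algebraMap K L b) : a = b :=
  RingOfIntegers.coe_injective ((algebraMap K L).injective h)

theorem sq_inj (F : Type) [Field F] [NumberField F] :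
    Function.Injective (powMonoidHom 2 : (FractionalIdeal (𝓞 F)⁰ F)ˣ →* _) := by
  rw [injective_iff_map_eq_one]
  intro I hI
  rw [powMonoidHom_apply, sq] at hI
  have hI' : (I : FractionalIdeal (𝓞 F)⁰ F) * I = 1 := by
    simpa using congrArg Units.val hI
  have hle : (I : FractionalIdeal (𝓞 F)⁰ F) ≤ 1 := by
    intro x hx
    have h1 : x * x ∈ (1 : FractionalIdeal (𝓞 F)⁰ F) := hI' ▸ FractionalIdeal.mul_mem_mul hx hx
    rw [← FractionalIdeal.spanSingleton_one, mem_span_iff _ _ one_ne_zero, div_one] at h1 ⊢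
    rw [← sq] at h1
    exact IsIntegral.of_pow (by norm_num) h1
  ext1
  apply le_antisymm hle
  calc (1 : FractionalIdeal (𝓞 F)⁰ F) = I * I := hI'.symm
    _ ≤ I * 1 := mul_le_mul_right hle _
    _ = I := mul_one _

theorem Quad.ram [IsPrincipalIdealRing (𝓞 K)] (h : Quad K L d s σ) (θ : L) (hθ : IsIntegral ℤ θ)
    (hw : (θ - σ θ) ^ 2 = - algebraMap K L d) (r l : 𝓞 K) (hl : Prime l) (hr0 : r ≠ 0)
    (hlr : l ∣ r) (hlr2 : ¬ l ^ 2 ∣ r)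
    (I : (FractionalIdeal (𝓞 L)⁰ L)ˣ)
    (hI : (I : FractionalIdeal (𝓞 L)⁰ L) * I =
      FractionalIdeal.spanSingleton (𝓞 L)⁰ (algebraMap K L r)) : l ∣ d := by
  by_contra hld
  have hcop : IsCoprime l d := (hl.irreducible.coprime_iff_not_dvd).mpr hld
  obtain ⟨a, b, hab⟩ := hcop
  have hr : algebraMap K L r ≠ 0 := by
    rw [Ne, map_eq_zero]; simpa using hr0
  have hl0 : algebraMap K L l ≠ 0 := by
    rw [Ne, map_eq_zero]; simpa using hl.ne_zero
  obtain ⟨r', hr'⟩ := hlr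
  have hrr : algebraMap K L r = algebraMap K L l * algebraMap K L r' := by
    rw [hr', co_mul]
  have key1 : ∀ x ∈ (I : FractionalIdeal (𝓞 L)⁰ L), IsIntegral ℤ ((x + σ x) / algebraMap K L l) := by
    intro x hx
    have h1 : IsIntegral ℤ (x * x / algebraMap K L r) := by
      rw [← mem_span_iff _ _ hr, ← hI]
      exact FractionalIdeal.mul_mem_mul hx hx
    have h2 := Quad.int_conj (σ := σ) _ h1
    rw [map_div₀, map_mul, AlgEquiv.commutes] at h2
    have h3 : IsIntegral ℤ (x * σ x / algebraMap K L r) := by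
      apply IsIntegral.of_pow (n := 2) (by norm_num)
      have : (x * σ x / algebraMap K L r) ^ 2 =
        (x * x / algebraMap K L r) * (σ x * σ x / algebraMap K L r) := by ring
      rw [this]; exact h1.mul h2
    have h4 : IsIntegral ℤ ((x + σ x) ^ 2 / algebraMap K L r) := by
      have : (x + σ x) ^ 2 / algebraMap K L r = x * x / algebraMap K L r +
        σ x * σ x / algebraMap K L r + (x * σ x / algebraMap K L r + x * σ x / algebraMap K L r) := by
        ring
      rw [this]; exact (h1.add h2).add (h3.add h3)
    have h5 : IsIntegral ℤ (x + σ x) := by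
      apply IsIntegral.of_pow (n := 2) (by norm_num)
      have : (x + σ x) ^ 2 = (x + σ x) ^ 2 / algebraMap K L r * algebraMap K L r := by field_simp
      rw [this]; exact h4.mul (int_up r)
    obtain ⟨t, ht⟩ := h.fixint (x + σ x) (by rw [map_add, h.invol, add_comm]) h5
    rw [ht] at h4 ⊢
    have h6 : l ∣ t ^ 2 := by
      rw [← map_pow, ← map_div₀] at h4
      obtain ⟨c, hc⟩ := int_down h4
      refine ⟨r' * c, ?_⟩
      apply RingOfIntegers.coe_injective
      have hrK : algebraMap (𝓞 K) K r ≠ 0 := by simpa using hr0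
      have hc' : algebraMap (𝓞 K) K c = (algebraMap (𝓞 K) K t) ^ 2 / algebraMap (𝓞 K) K r := hc
      rw [map_pow, ← mul_assoc, ← hr', map_mul, hc']
      field_simp
    obtain ⟨t', rfl⟩ := hl.dvd_of_dvd_pow h6
    rw [co_mul, mul_div_cancel_left₀ _ hl0]
    exact int_up t'
  have key2 : ∀ x ∈ (I : FractionalIdeal (𝓞 L)⁰ L), IsIntegral ℤ (x / algebraMap K L l) := by
    intro x hx
    have h1 := key1 x hx
    have h2 := key1 _ (smul_mem_frac _ x θ hx hθ)
    have h3 : IsIntegral ℤ (algebraMap K L d * x / algebraMap K L l) := by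
      have : algebraMap K L d * x / algebraMap K L l = (θ - σ θ) *
        ((x + σ x) / algebraMap K L l * σ θ - (θ * x + σ (θ * x)) / algebraMap K L l) := by
        rw [map_mul]
        field_simp
        linear_combination x * hw
      rw [this]
      exact (hθ.sub (Quad.int_conj θ hθ)).mul ((h1.mul (Quad.int_conj θ hθ)).sub h2)
    have h0 : IsIntegral ℤ x := by
      have : IsIntegral ℤ (x * x / algebraMap K L r) := by
        rw [← mem_span_iff _ _ hr, ← hI]
        exact FractionalIdeal.mul_mem_mul hx hx
      apply IsIntegral.of_pow (n := 2) (by norm_num)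
      have e : x ^ 2 = x * x / algebraMap K L r * algebraMap K L r := by field_simp
      rw [e]; exact this.mul (int_up r)
    have habL : algebraMap K L a * algebraMap K L l + algebraMap K L b * algebraMap K L d = 1 := by
      rw [← co_mul, ← co_mul, ← co_add, hab, co_one]
    have : x / algebraMap K L l = algebraMap K L a * x +
        algebraMap K L b * (algebraMap K L d * x / algebraMap K L l) := by
      field_simp
      linear_combination - x * habL
    rw [this]
    exact ((int_up a).mul h0).add ((int_up b).mul h3)
  have hle : (I : FractionalIdeal (𝓞 L)⁰ L) ≤
      FractionalIdeal.spanSingleton (𝓞 L)⁰ (algebraMap K L l) := by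
    intro x hx
    rw [mem_span_iff _ _ hl0]
    exact key2 x hx
  have hrm : algebraMap K L r ∈ (I : FractionalIdeal (𝓞 L)⁰ L) * I := by
    rw [hI]; exact FractionalIdeal.mem_spanSingleton_self _ _
  have hrm2 := mul_le_mul' hle hle hrm
  rw [FractionalIdeal.spanSingleton_mul_spanSingleton, mem_span_iff _ _ (mul_ne_zero hl0 hl0)] at hrm2
  apply hlr2
  rw [← map_mul, ← map_div₀] at hrm2
  obtain ⟨c, hc⟩ := int_down hrm2
  refine ⟨c, ?_⟩
  apply RingOfIntegers.coe_injective
  have hlK : algebraMap (𝓞 K) K l ≠ 0 := by simpa using hl.ne_zero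
  have hc' : algebraMap (𝓞 K) K c = algebraMap (𝓞 K) K r / (algebraMap (𝓞 K) K l * algebraMap (𝓞 K) K l) := hc
  rw [map_mul, map_pow, hc']
  field_simp

end
end LdProof

namespace LdProof
open scoped nonZeroDivisors

section ufd
set_option linter.unusedSectionVars false
variable {R : Type} [CommRing R] [IsDomain R]

theorem sf_decomp [UniqueFactorizationMonoid R] (x : R) (hx : x ≠ 0) :
    ∃ r k : R, r ≠ 0 ∧ k ≠ 0 ∧ Squarefree r ∧ x = r * k ^ 2 := by
  induction x using UniqueFactorizationMonoid.induction_on_prime with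
  | h₁ => exact absurd rfl hx
  | h₂ x hu => exact ⟨x, 1, hx, one_ne_zero, hu.squarefree, by ring⟩
  | h₃ a p ha hp ih =>
    obtain ⟨r, k, hr, hk, hsf, rfl⟩ := ih ha
    by_cases hpr : p ∣ r
    · obtain ⟨r', rfl⟩ := hpr
      exact ⟨r', p * k, right_ne_zero_of_mul hr, mul_ne_zero hp.ne_zero hk,
        hsf.squarefree_of_dvd (dvd_mul_left _ _), by ring⟩
    · refine ⟨p * r, k, mul_ne_zero hp.ne_zero hr, hk, ?_, by ring⟩
      rw [squarefree_mul_iff]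
      refine ⟨?_, hp.irreducible.squarefree, hsf⟩
      rw [hp.irreducible.isRelPrime_iff_not_dvd]
      exact hpr

theorem sf_dvd [UniqueFactorizationMonoid R] (m x : R) (hx : x ≠ 0) (hsf : Squarefree x)
    (h : ∀ p, Prime p → p ∣ x → p ∣ m) : x ∣ m := by
  induction x using UniqueFactorizationMonoid.induction_on_prime with
  | h₁ => exact absurd rfl hx
  | h₂ x hu => exact hu.dvd
  | h₃ a p ha hp ih =>
    obtain ⟨c, rfl⟩ := ih ha (hsf.squarefree_of_dvd (dvd_mul_left _ _))
      (fun l hl hla => h l hl (hla.mul_left _))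
    have hpa : ¬ p ∣ a := by
      rintro ⟨b, rfl⟩
      exact hp.not_isUnit (hsf p ⟨b, by ring⟩)
    have := (hp.dvd_or_dvd (h p hp (dvd_mul_right _ _))).resolve_left hpa
    rw [mul_comm p a]
    exact mul_dvd_mul_left a this

theorem parity (π m m' : R) (hπ : Prime π) (hm : π ∣ m) (hm2 : ¬ π ^ 2 ∣ m) (hm' : ¬ π ∣ m') (n : ℕ) :
    ∀ x y : R, m * y ^ 2 = m' * x ^ 2 → ¬ π ^ n ∣ y → False := by
  obtain ⟨m1, rfl⟩ := hm
  have hm1 : ¬ π ∣ m1 := fun ⟨e, he⟩ => hm2 ⟨e, by rw [he]; ring⟩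
  have h0 := hπ.ne_zero
  induction n with
  | zero => intro x y _ h; simp at h
  | succ n ih =>
    intro x y h hn
    have hx : π ∣ x := by
      have : π ∣ m' * x ^ 2 := ⟨m1 * y ^ 2, by rw [← h]; ring⟩
      exact hπ.dvd_of_dvd_pow ((hπ.dvd_or_dvd this).resolve_left hm')
    obtain ⟨x', rfl⟩ := hx
    have hy : π ∣ y := by
      have : π ∣ m1 * y ^ 2 := by
        refine ⟨m' * x' ^ 2, ?_⟩
        apply mul_left_cancel₀ h0
        linear_combination h
      exact hπ.dvd_of_dvd_pow ((hπ.dvd_or_dvd this).resolve_left hm1)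
    obtain ⟨y', rfl⟩ := hy
    refine ih x' y' ?_ ?_
    · apply mul_left_cancel₀ (pow_ne_zero 2 h0)
      linear_combination h
    · intro h'
      apply hn
      rw [pow_succ']
      exact mul_dvd_mul_left π h'

theorem prod_ndvd (π : Fin 4 → R) (hπ : ∀ i, Prime (π i))
    (hna : ∀ i j, i ≠ j → ¬ Associated (π i) (π j)) (S : Finset (Fin 4)) (i : Fin 4) (hi : i ∉ S) : ¬ π i ∣ ∏ j ∈ S, π j := by
  rw [(hπ i).dvd_finsetProd_iff]
  rintro ⟨j, hj, h⟩
  exact hna i j (by rintro rfl; exact hi hj) ((hπ i).associated_of_dvd (hπ j) h)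

theorem prod_ndvd2 (π : Fin 4 → R) (hπ : ∀ i, Prime (π i))
    (hna : ∀ i j, i ≠ j → ¬ Associated (π i) (π j)) (S : Finset (Fin 4)) (i : Fin 4) : ¬ π i ^ 2 ∣ ∏ j ∈ S, π j := by
  by_cases hi : i ∈ S
  · rw [← Finset.mul_prod_erase S π hi, sq]
    intro h
    exact prod_ndvd π hπ hna _ i (Finset.notMem_erase i S)
      ((mul_dvd_mul_iff_left (hπ i).ne_zero).mp h)
  · intro h
    exact prod_ndvd π hπ hna S i hi ((dvd_pow_self _ two_ne_zero).trans h)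

theorem prod_sub (π : Fin 4 → R) (hπ : ∀ i, Prime (π i))
    (hna : ∀ i j, i ≠ j → ¬ Associated (π i) (π j)) (S T : Finset (Fin 4)) (u : Rˣ) (x y : R) (hy : y ≠ 0) [IsNoetherianRing R]
    (h : (∏ j ∈ S, π j) * y ^ 2 = u * (∏ j ∈ T, π j) * x ^ 2) : S ⊆ T := by
  intro i hi
  by_contra hiT
  have hfm : FiniteMultiplicity (π i) y :=
    FiniteMultiplicity.of_not_isUnit (hπ i).not_isUnit hy
  obtain ⟨n, hn⟩ := hfm
  refine parity (π i) _ _ (hπ i) (Finset.dvd_prod_of_mem π hi) (prod_ndvd2 π hπ hna S i) ?_ (n + 1)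
    x y h hn
  rw [Units.dvd_mul_left]
  exact prod_ndvd π hπ hna T i hiT

end ufd

section
set_option linter.unusedSectionVars false
variable {K L : Type} [Field K] [NumberField K] [Field L] [NumberField L] [Algebra K L]
    {d : 𝓞 K} {s : L} {σ : L ≃ₐ[K] L}

theorem Quad.s_int (h : Quad K L d s σ) : IsIntegral ℤ s := by
  apply IsIntegral.of_pow (n := 2) (by norm_num)
  rw [h.ssq]; exact int_up d

/-- A nonzero integer as an element of the multiplicative group. -/
noncomputable def mkU (r : 𝓞 K) (hr : r ≠ 0) : Kˣ := Units.mk0 (r : K) (by simpa using hr)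

theorem mkU_coe (r : 𝓞 K) (hr : r ≠ 0) : (mkU r hr : K) = r := rfl

theorem Quad.ramideal (h : Quad K L d s σ) (π d' : 𝓞 K) (hπ : π ≠ 0) (hd : d = π * d')
    (hc : IsCoprime π d') : ∃ I : (FractionalIdeal (𝓞 L)⁰ L)ˣ,
      I ^ 2 = toPrincipalIdeal (𝓞 L) L (kL K L (mkU π hπ)) := by
  obtain ⟨x, y, hxy⟩ := hc
  have hπ0 : algebraMap K L π ≠ 0 := by
    rw [Ne, map_eq_zero]; simpa using hπ
  have hdL : algebraMap K L d = algebraMap K L π * algebraMap K L d' := by rw [hd, co_mul]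
  have hL : algebraMap K L x * algebraMap K L π + algebraMap K L y * algebraMap K L d' = 1 := by
    rw [← co_mul, ← co_mul, ← co_add, hxy, co_one]
  let J : FractionalIdeal (𝓞 L)⁰ L := FractionalIdeal.spanSingleton _ (algebraMap K L π) +
    FractionalIdeal.spanSingleton _ s
  have hJ1 : algebraMap K L π ∈ J := by
    have : FractionalIdeal.spanSingleton (𝓞 L)⁰ (algebraMap K L π) ≤ J := by
      simp only [J, ← FractionalIdeal.sup_eq_add]; exact le_sup_left
    exact this (FractionalIdeal.mem_spanSingleton_self _ _)
  have hJ2 : s ∈ J := by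
    have : FractionalIdeal.spanSingleton (𝓞 L)⁰ s ≤ J := by
      simp only [J, ← FractionalIdeal.sup_eq_add]; exact le_sup_right
    exact this (FractionalIdeal.mem_spanSingleton_self _ _)
  have hJ : J * J = FractionalIdeal.spanSingleton _ (algebraMap K L π) := by
    apply le_antisymm
    · simp only [J, add_mul, mul_add, FractionalIdeal.spanSingleton_mul_spanSingleton]
      simp only [← FractionalIdeal.sup_eq_add]
      refine sup_le (sup_le ?_ ?_) (sup_le ?_ ?_) <;>
        rw [FractionalIdeal.spanSingleton_le_iff_mem, mem_span_iff _ _ hπ0]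
      · rw [mul_div_cancel_left₀ _ hπ0]; exact int_up π
      · rw [mul_div_cancel_right₀ _ hπ0]; exact h.s_int
      · rw [mul_div_cancel_left₀ _ hπ0]; exact h.s_int
      · rw [← sq, h.ssq, hdL, mul_div_cancel_left₀ _ hπ0]; exact int_up d'
    · rw [FractionalIdeal.spanSingleton_le_iff_mem]
      have : algebraMap K L π = algebraMap K L x * (algebraMap K L π * algebraMap K L π) +
          algebraMap K L y * (s * s) := by
        rw [← sq s, h.ssq, hdL]
        linear_combination -(algebraMap K L π) * hL
      rw [this]
      exact (J * J).val.add_mem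
        (smul_mem_frac _ _ _ (FractionalIdeal.mul_mem_mul hJ1 hJ1) (int_up x))
        (smul_mem_frac _ _ _ (FractionalIdeal.mul_mem_mul hJ2 hJ2) (int_up y))
  refine ⟨⟨J, J * FractionalIdeal.spanSingleton _ (algebraMap K L π)⁻¹, ?_, ?_⟩, ?_⟩
  · rw [← mul_assoc, hJ, FractionalIdeal.spanSingleton_mul_spanSingleton, mul_inv_cancel₀ hπ0,
      FractionalIdeal.spanSingleton_one]
  · rw [mul_comm, ← mul_assoc, hJ, FractionalIdeal.spanSingleton_mul_spanSingleton,
      mul_inv_cancel₀ hπ0, FractionalIdeal.spanSingleton_one]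
  · rw [eq_comm, toPrincipalIdeal_eq_iff, sq]
    exact hJ.symm

end
end LdProof

namespace LdProof
open scoped nonZeroDivisors

section
set_option linter.unusedSectionVars false
variable {K L : Type} [Field K] [NumberField K] [Field L] [NumberField L] [Algebra K L]
    {d : 𝓞 K} {s : L} {σ : L ≃ₐ[K] L}

theorem mem_B (c : Kˣ) :
    c ∈ ((PK K L).map (powMonoidHom 2)).comap ((toPrincipalIdeal (𝓞 L) L).comp (kL K L)) ↔
      ∃ u : (𝓞 K)ˣ, ∃ k : Kˣ, (c : K) = ((u : 𝓞 K) : K) * (k : K) ^ 2 := by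
  rw [Subgroup.mem_comap]
  constructor
  · rintro ⟨_, ⟨k, rfl⟩, hk⟩
    rw [powMonoidHom_apply, ← map_pow, MonoidHom.comp_apply, MonoidHom.comp_apply, eq_comm,
      prin_eq_iff, ← map_div, kL_unit] at hk
    obtain ⟨u, hu⟩ := hk
    refine ⟨u, k, ?_⟩
    rw [eq_div_iff_mul_eq'] at hu
    rw [← hu]
    simp
  · rintro ⟨u, k, hc⟩
    refine ⟨_, ⟨k, rfl⟩, ?_⟩
    rw [powMonoidHom_apply, ← map_pow, MonoidHom.comp_apply, MonoidHom.comp_apply, eq_comm,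
      prin_eq_iff, ← map_div, kL_unit]
    refine ⟨u, ?_⟩
    rw [eq_div_iff_mul_eq']
    ext
    simp [hc]

theorem Quad.N1 [IsPrincipalIdealRing (𝓞 K)] (h : Quad K L d s σ) (θ : L) (hθ : IsIntegral ℤ θ)
    (hw : (θ - σ θ) ^ 2 = - algebraMap K L d) (π : Fin 4 → 𝓞 K) (hπ : ∀ i, Prime (π i))
    (hna : ∀ i j, i ≠ j → ¬ Associated (π i) (π j)) (hd : d = ∏ i, π i) :
    (PK K L).relIndex (Agrp K L) = 16 := by
  classical
  let ι := (toPrincipalIdeal (𝓞 L) L).comp (kL K L)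
  let sq2 : (FractionalIdeal (𝓞 L)⁰ L)ˣ →* (FractionalIdeal (𝓞 L)⁰ L)ˣ := powMonoidHom 2
  let H : Subgroup Kˣ := sq2.range.comap ι
  have e1 : (Agrp K L).map sq2 = H.map ι := by
    rw [Agrp, Subgroup.map_comap_eq, Subgroup.map_comap_eq, inf_comm]
    rfl
  rw [← Subgroup.relIndex_map_map_of_injective _ _ (sq_inj L)]
  change ((PK K L).map sq2).relIndex ((Agrp K L).map sq2) = 16
  rw [e1, ← Subgroup.relIndex_comap]
  have hP0 : ∀ S : Finset (Fin 4), ∏ j ∈ S, π j ≠ 0 :=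
    fun S => Finset.prod_ne_zero_iff.mpr (fun j _ => (hπ j).ne_zero)
  have hcop : ∀ i j, i ≠ j → IsCoprime (π i) (π j) := by
    intro i j hij
    rw [(hπ i).irreducible.coprime_iff_not_dvd]
    intro hd
    exact hna i j hij ((hπ i).associated_of_dvd (hπ j) hd)
  have hmem : ∀ S : Finset (Fin 4), mkU (∏ j ∈ S, π j) (hP0 S) ∈ H := by
    intro S
    have : mkU (∏ j ∈ S, π j) (hP0 S) = ∏ j ∈ S, mkU (π j) (hπ j).ne_zero := by
      ext
      rw [Units.coe_prod, mkU_coe]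
      exact map_prod (algebraMap (𝓞 K) K) _ _
    rw [this]
    apply Subgroup.prod_mem
    intro j _
    obtain ⟨I, hI⟩ := h.ramideal (π j) (∏ i ∈ Finset.univ.erase j, π i) (hπ j).ne_zero
      (by rw [hd, Finset.mul_prod_erase _ _ (Finset.mem_univ j)])
      (IsCoprime.prod_right (fun i hi => hcop j i (Finset.ne_of_mem_erase hi).symm))
    exact ⟨I, hI⟩
  let B := ((PK K L).map sq2).comap ι
  change (B.subgroupOf H).index = 16
  let f : Finset (Fin 4) → H ⧸ B.subgroupOf H := fun S => QuotientGroup.mk ⟨_, hmem S⟩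
  have hf1 : ∀ S T, f S = f T → T ⊆ S := by
    intro S T hST
    have := QuotientGroup.eq.mp hST
    rw [Subgroup.mem_subgroupOf] at this
    obtain ⟨u, k, hc⟩ := (mem_B _).mp this
    obtain ⟨x, y, hy, hk⟩ := IsFractionRing.div_surjective (A := 𝓞 K) (k : K)
    have hy0 := nonZeroDivisors.ne_zero hy
    refine prod_sub π hπ hna T S u x y hy0 ?_
    have hy0' : algebraMap (𝓞 K) K y ≠ 0 := by simpa using hy0
    have hS0' : algebraMap (𝓞 K) K (∏ j ∈ S, π j) ≠ 0 :=
      fun h0 => hP0 S (RingOfIntegers.coe_injective (by rw [h0, map_zero]))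
    have hc' : (algebraMap (𝓞 K) K (∏ j ∈ S, π j))⁻¹ * algebraMap (𝓞 K) K (∏ j ∈ T, π j) =
      algebraMap (𝓞 K) K u * (k : K) ^ 2 := by
      rw [← hc]
      rw [Subgroup.coe_mul, Subgroup.coe_inv, Units.val_mul, Units.val_inv_eq_inv_val]
      rfl
    rw [← hk] at hc'
    apply RingOfIntegers.coe_injective
    rw [map_mul, map_mul, map_mul, map_pow, map_pow]
    field_simp at hc'
    linear_combination hc'
  have hf2 : Function.Surjective f := by
    intro c
    obtain ⟨⟨a, ha⟩, rfl⟩ := QuotientGroup.mk_surjective c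
    obtain ⟨n, m, hm, hnm⟩ := IsFractionRing.div_surjective (A := 𝓞 K) (a : K)
    have hm0 := nonZeroDivisors.ne_zero hm
    have hm0' : algebraMap (𝓞 K) K m ≠ 0 := by simpa using hm0
    have hn0 : n ≠ 0 := by
      rintro rfl
      rw [map_zero, zero_div] at hnm
      exact a.ne_zero hnm.symm
    obtain ⟨r, k, hr0, hk0, hsf, hrk⟩ := sf_decomp (n * m) (mul_ne_zero hn0 hm0)
    have hk0' : algebraMap (𝓞 K) K k ≠ 0 := by simpa using hk0
    have har : a = mkU r hr0 * (mkU k hk0 / mkU m hm0) ^ 2 := by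
      ext
      rw [Units.val_mul, Units.val_pow_eq_pow_val, Units.val_div_eq_div_val]
      change (a : K) = algebraMap (𝓞 K) K r * (algebraMap (𝓞 K) K k / algebraMap (𝓞 K) K m) ^ 2
      have := congrArg (algebraMap (𝓞 K) K) hrk
      rw [map_mul, map_mul, map_pow] at this
      rw [← hnm]
      field_simp
      linear_combination this
    obtain ⟨I, hI⟩ := ha
    have hI2 : (I / ι (mkU k hk0 / mkU m hm0)) ^ 2 = ι (mkU r hr0) := by
      have hI' : I ^ 2 = ι a := hI
      rw [div_pow, hI', har, map_mul, map_pow, mul_div_cancel_right]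
    have hI3 : ((I / ι (mkU k hk0 / mkU m hm0) : (FractionalIdeal (𝓞 L)⁰ L)ˣ) :
      FractionalIdeal (𝓞 L)⁰ L) * (I / ι (mkU k hk0 / mkU m hm0) : (FractionalIdeal (𝓞 L)⁰ L)ˣ) =
      FractionalIdeal.spanSingleton (𝓞 L)⁰ (algebraMap K L r) := by
      rw [← Units.val_mul, ← sq, hI2]
      change ((toPrincipalIdeal (𝓞 L) L (kL K L (mkU r hr0)) : (FractionalIdeal (𝓞 L)⁰ L)ˣ) :
        FractionalIdeal (𝓞 L)⁰ L) = _
      rw [coe_toPrincipalIdeal, kL_coe, mkU_coe]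
    have hpd : ∀ l, Prime l → l ∣ r → l ∣ d := by
      intro l hl hlr
      refine h.ram θ hθ hw r l hl hr0 hlr ?_ _ hI3
      intro h2
      exact hl.not_isUnit (hsf l (by rwa [← sq]))
    let S : Finset (Fin 4) := Finset.univ.filter (fun i => π i ∣ r)
    have d1 : (∏ j ∈ S, π j) ∣ r := by
      apply Finset.prod_dvd_of_coprime
      · intro i _ j _ hij; exact hcop i j hij
      · intro i hi; exact (Finset.mem_filter.mp hi).2
    have d2 : r ∣ ∏ j ∈ S, π j := by
      apply sf_dvd _ _ hr0 hsf
      intro l hl hlr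
      have := hpd l hl hlr
      rw [hd, hl.dvd_finsetProd_iff] at this
      obtain ⟨i, _, hi⟩ := this
      have has := hl.associated_of_dvd (hπ i) hi
      apply hi.trans
      apply Finset.dvd_prod_of_mem
      exact Finset.mem_filter.mpr ⟨Finset.mem_univ i, has.symm.dvd.trans hlr⟩
    obtain ⟨u, hu⟩ := associated_of_dvd_dvd d1 d2
    refine ⟨S, ?_⟩
    apply QuotientGroup.eq.mpr
    rw [Subgroup.mem_subgroupOf]
    apply (mem_B _).mpr
    refine ⟨u, mkU k hk0 / mkU m hm0, ?_⟩
    have hS0' : algebraMap (𝓞 K) K (∏ j ∈ S, π j) ≠ 0 :=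
      fun h0 => hP0 S (RingOfIntegers.coe_injective (by rw [h0, map_zero]))
    have har' := congrArg Units.val har
    rw [Units.val_mul, Units.val_pow_eq_pow_val] at har'
    rw [Subgroup.coe_mul, Subgroup.coe_inv, Units.val_mul, Units.val_inv_eq_inv_val]
    change (algebraMap (𝓞 K) K (∏ j ∈ S, π j))⁻¹ * (a : K) = algebraMap (𝓞 K) K u * _
    rw [har']
    change _ * (algebraMap (𝓞 K) K r * _) = _
    rw [← hu, map_mul, mul_assoc, inv_mul_cancel_left₀ hS0']
  have hbij : Function.Bijective f :=
    ⟨fun S T hST => Finset.Subset.antisymm (hf1 T S hST.symm) (hf1 S T hST), hf2⟩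
  rw [Subgroup.index, ← Nat.card_eq_of_bijective f hbij, Nat.card_eq_fintype_card, Fintype.card_finset,
    Fintype.card_fin]
  norm_num

end
end LdProof

namespace LdProof
open scoped nonZeroDivisors

section
set_option linter.unusedSectionVars false
variable {K L : Type} [Field K] [NumberField K] [Field L] [NumberField L] [Algebra K L]
    {d : 𝓞 K} {s : L} {σ : L ≃ₐ[K] L}

theorem mk_one_iff (I : (FractionalIdeal (𝓞 L)⁰ L)ˣ) :
    ClassGroup.mk L I = 1 ↔ I ∈ (toPrincipalIdeal (𝓞 L) L).range := by
  rw [ClassGroup.mk_eq_one_iff, mem_principal_ideals_iff]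
  constructor
  · rintro ⟨x, hx⟩
    refine ⟨x, ?_⟩
    apply FractionalIdeal.coeToSubmodule_injective
    change ((FractionalIdeal.spanSingleton (𝓞 L)⁰ x : FractionalIdeal (𝓞 L)⁰ L) : Submodule (𝓞 L) L) = _
    rw [FractionalIdeal.coe_spanSingleton, ← hx]
  · rintro ⟨x, hx⟩
    rw [← hx, FractionalIdeal.coe_spanSingleton]
    exact ⟨x, rfl⟩

theorem norm_sq [IsPrincipalIdealRing (𝓞 K)] (I : Ideal (𝓞 L)) (γ : 𝓞 L) (hγ : γ ≠ 0)
    (hI : I ^ 2 = Ideal.span {γ}) : ∃ n : 𝓞 K, n ≠ 0 ∧ ∃ u : (𝓞 K)ˣ,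
      Algebra.norm K (γ : L) = (n : K) ^ 2 * ((u : 𝓞 K) : K) := by
  obtain ⟨n, hn⟩ := IsPrincipalIdealRing.principal (Ideal.relNorm (𝓞 K) I)
  change _ = Ideal.span {n} at hn
  have h1 := congrArg (Ideal.relNorm (𝓞 K)) hI
  rw [map_pow, hn, Ideal.relNorm_singleton, Ideal.span_singleton_pow,
    Ideal.span_singleton_eq_span_singleton] at h1
  obtain ⟨u, hu⟩ := h1
  have h2 := Algebra.algebraMap_intNorm (A := 𝓞 K) (K := K) (L := L) γ
  rw [← hu, map_mul, map_pow] at h2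
  refine ⟨n, ?_, u, h2.symm⟩
  rintro rfl
  rw [map_zero, zero_pow two_ne_zero, zero_mul, eq_comm, Algebra.norm_eq_zero_iff] at h2
  exact hγ (RingOfIntegers.coe_injective (by rw [h2, map_zero]))

theorem cl_rep (c : ClassGroup (𝓞 L)) (hc : c ^ 2 = 1) :
    ∃ (I : (Ideal (𝓞 L))⁰) (γ : 𝓞 L), γ ≠ 0 ∧ ClassGroup.mk0 I = c ∧
      (I : Ideal (𝓞 L)) ^ 2 = Ideal.span {γ} := by
  obtain ⟨I, hI⟩ := ClassGroup.mk0_surjective c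
  have hI2 : (I : Ideal (𝓞 L)) ^ 2 ∈ (Ideal (𝓞 L))⁰ := pow_mem I.2 2
  have h1 : ClassGroup.mk0 (⟨(I : Ideal (𝓞 L)) ^ 2, hI2⟩ : (Ideal (𝓞 L))⁰) = 1 := by
    rw [← hc, ← hI, ← map_pow]
    rfl
  obtain ⟨γ, hγ⟩ := ((ClassGroup.mk0_eq_one_iff hI2).mp h1).principal
  have hγ' : (I : Ideal (𝓞 L)) ^ 2 = Ideal.span {γ} := hγ
  refine ⟨I, γ, ?_, hI, hγ'⟩
  rintro rfl
  apply nonZeroDivisors.ne_zero hI2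
  rw [hγ']
  simp

theorem Quad.surj [IsPrincipalIdealRing (𝓞 K)] (h : Quad K L d s σ) (hkey : KeyProp σ)
    (hnorm : ∀ x : L, algebraMap K L (Algebra.norm K x) = x * σ x)
    (c : ClassGroup (𝓞 L)) (hc : c ^ 2 = 1) : ∃ J ∈ Agrp K L, ClassGroup.mk L J = c := by
  obtain ⟨I, γ, hγ0, rfl, hγ⟩ := cl_rep c hc
  obtain ⟨n, hn0, u, hu⟩ := norm_sq (K := K) (I : Ideal (𝓞 L)) γ hγ0 hγ
  obtain ⟨g, hgγ⟩ : ∃ g : Lˣ, (g : L) = (γ : L) := ⟨mkU γ hγ0, rfl⟩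
  obtain ⟨w, hw, hwu⟩ : ∃ w : Kˣ, w ∈ unitsIn K ∧ (w : K) = ((u : 𝓞 K) : K) :=
    ⟨Units.map (algebraMap (𝓞 K) K : 𝓞 K →* K) u, ⟨u, rfl⟩, rfl⟩
  have hg : g * sg σ g = kL K L (mkU n hn0) ^ 2 * kL K L w := by
    ext
    have := hnorm (γ : L)
    rw [hu, map_mul, map_pow] at this
    rw [Units.val_mul, Units.val_mul, Units.val_pow_eq_pow_val, sg_coe, kL_coe, kL_coe, mkU_coe,
      hgγ, hwu, this]
  have hx : (kL K L (mkU n hn0) / g) * sg σ (kL K L (mkU n hn0) / g) = kL K L w⁻¹ := by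
    rw [map_div, sg_kL, div_mul_div_comm, hg, map_inv, sq, div_mul_cancel_left]
  obtain ⟨v, hv, hvw⟩ := hkey _ _ (inv_mem hw) hx
  obtain ⟨b, hb⟩ := h.sg_hilbert (kL K L (mkU n hn0) / g / kL K L v) (by
    rw [map_div, sg_kL, div_mul_div_comm, hx, hvw, map_pow, sq, div_self'])
  obtain ⟨a, ha⟩ := h.sg_norm b
  refine ⟨toPrincipalIdeal (𝓞 L) L b * FractionalIdeal.mk0 L I, ?_, ?_⟩
  · rw [mem_Agrp]
    have hIg : (FractionalIdeal.mk0 L I) ^ 2 = toPrincipalIdeal (𝓞 L) L g := by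
      rw [eq_comm, toPrincipalIdeal_eq_iff, Units.val_pow_eq_pow_val, FractionalIdeal.coe_mk0,
        ← FractionalIdeal.coeIdeal_pow, hγ, FractionalIdeal.coeIdeal_span_singleton, hgγ]
    refine ⟨mkU n hn0 / v * a, ?_⟩
    rw [mul_pow, hIg, ← map_pow, ← map_mul]
    congr 1
    rw [map_mul, map_div, ← ha]
    have hb' : kL K L (mkU n hn0) / kL K L v = g * (b / sg σ b) := by
      rw [← hb, div_right_comm, mul_div_cancel]
    rw [hb', sq, mul_assoc, div_mul_eq_mul_div, ← mul_assoc b b, mul_div_cancel_right, mul_comm]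
  · rw [map_mul, ClassGroup.mk_mk0, (mk_one_iff _).mpr ⟨b, rfl⟩, one_mul]

theorem Quad.final [IsPrincipalIdealRing (𝓞 K)] (h : Quad K L d s σ) (hkey : KeyProp σ)
    (hnorm : ∀ x : L, algebraMap K L (Algebra.norm K x) = x * σ x)
    (h8 : (PK K L).relIndex ((toPrincipalIdeal (𝓞 L) L).range ⊓ Agrp K L) = 8)
    (h16 : (PK K L).relIndex (Agrp K L) = 16) (P : Sylow 2 (ClassGroup (𝓞 L))) :
    IsCyclic P ∧ Nontrivial P := by
  let PL := (toPrincipalIdeal (𝓞 L) L).range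
  have hle : PK K L ≤ PL ⊓ Agrp K L := by
    rintro I ⟨a, rfl⟩
    refine ⟨⟨kL K L a, rfl⟩, (mem_Agrp _).mpr ⟨a ^ 2, ?_⟩⟩
    rw [map_pow, map_pow]; rfl
  have h2 : PL.relIndex (Agrp K L) = 2 := by
    have := Subgroup.relIndex_mul_relIndex (PK K L) (PL ⊓ Agrp K L) (Agrp K L) hle inf_le_right
    rw [h8, h16, Subgroup.inf_relIndex_right] at this
    omega
  have hdiv : ∀ x y : (FractionalIdeal (𝓞 L)⁰ L)ˣ, ClassGroup.mk L x = ClassGroup.mk L y ↔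
      x * y⁻¹ ∈ PL := by
    intro x y
    rw [← mk_one_iff, map_mul, map_inv, mul_inv_eq_one]
  obtain ⟨⟨a, ha⟩, haP⟩ := Subgroup.index_eq_two_iff.mp h2
  have haP' : ∀ b ∈ Agrp K L, Xor (b * a ∈ PL) (b ∈ PL) := fun b hb => haP ⟨b, hb⟩
  have key : ∀ J ∈ Agrp K L, (ClassGroup.mk L J) ^ 2 = 1 := by
    rintro J ⟨b, hb⟩
    rw [← map_pow, mk_one_iff]
    exact ⟨kL K L b, hb⟩
  have ha2 := key a ha
  have hm : ∀ b ∈ Agrp K L, (b * a ∈ PL ↔ ClassGroup.mk L b = ClassGroup.mk L a) := by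
    intro b hb
    rw [← mk_one_iff, map_mul, mul_eq_one_iff_eq_inv]
    rw [sq, mul_eq_one_iff_eq_inv] at ha2
    rw [← ha2]
  refine sylow_final (ClassGroup.mk L a) ?_ ha2 ?_ P
  · intro h1
    rw [mk_one_iff] at h1
    rcases haP' 1 (one_mem _) with ⟨h3, h4⟩ | ⟨h3, h4⟩
    · exact h4 (one_mem _)
    · rw [one_mul] at h4; exact h4 h1
  · intro c hc
    obtain ⟨J, hJ, rfl⟩ := h.surj hkey hnorm c hc
    rw [← hm J hJ, mk_one_iff]
    rcases haP' J hJ with ⟨h3, h4⟩ | ⟨h3, h4⟩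
    · right; exact h3
    · left; exact h3

end
end LdProof

namespace LdProof
open scoped nonZeroDivisors

theorem primes4 (K : Type) [Field K] [NumberField K] [IsCyclotomicExtension {8} ℚ K]
    (q p : ℕ) [hq : Fact q.Prime] [hp : Fact p.Prime] (hq8 : q % 8 = 3) (hp8 : p % 8 = 5) :
    ∃ π : Fin 4 → 𝓞 K, (∀ i, Prime (π i)) ∧ (∀ i j, i ≠ j → ¬ Associated (π i) (π j)) ∧
      ((q * p : ℕ) : 𝓞 K) = ∏ i, π i ∧ π 0 ∣ (q : 𝓞 K) ∧ π 2 ∣ (p : 𝓞 K) := by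
  obtain ⟨a, b, ha, hb, hab, hqab⟩ := primes_aux K q (Or.inl hq8)
  obtain ⟨c, e, hc, he, hce, hpce⟩ := primes_aux K p (Or.inr hp8)
  have hne : q ≠ p := by omega
  have hcop : IsCoprime (q : 𝓞 K) (p : 𝓞 K) := by
    have := Nat.isCoprime_iff_coprime.mpr ((Nat.coprime_primes hq.out hp.out).mpr hne)
    simpa using this.map (Int.castRingHom (𝓞 K))
  have cross : ∀ x y : 𝓞 K, Prime x → x ∣ (q : 𝓞 K) → y ∣ (p : 𝓞 K) → ¬ Associated x y := by
    intro x y hx h1 h2 h3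
    exact hx.not_isUnit (hcop.isUnit_of_dvd' h1 (h3.dvd.trans h2))
  have aq : a ∣ (q : 𝓞 K) := ⟨b, hqab⟩
  have bq : b ∣ (q : 𝓞 K) := ⟨a, by rw [hqab, mul_comm]⟩
  have cp : c ∣ (p : 𝓞 K) := ⟨e, hpce⟩
  have ep : e ∣ (p : 𝓞 K) := ⟨c, by rw [hpce, mul_comm]⟩
  refine ⟨![a, b, c, e], ?_, ?_, ?_, aq, cp⟩
  · intro i
    fin_cases i
    exacts [ha, hb, hc, he]
  · have hlt : ∀ i j : Fin 4, i < j → ¬ Associated (![a, b, c, e] i) (![a, b, c, e] j) := by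
      intro i j hij
      fin_cases i <;> fin_cases j <;> first | (exfalso; revert hij; decide) | skip
      exacts [hab, cross a c ha aq cp, cross a e ha aq ep, cross b c hb bq cp, cross b e hb bq ep, hce]
    intro i j hij
    rcases lt_or_gt_of_ne hij with h | h
    · exact hlt i j h
    · exact fun h' => hlt j i h h'.symm
  · rw [Fin.prod_univ_four, Nat.cast_mul, hqab, hpce]
    change a * b * (c * e) = a * b * c * e
    ring

section
set_option linter.unusedSectionVars false
variable {K L : Type} [Field K] [NumberField K] [Field L] [NumberField L] [Algebra K L]
    {s : L} {σ : L ≃ₐ[K] L}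

theorem Quad.conclude [IsCyclotomicExtension {8} ℚ K] (q p : ℕ) [Fact q.Prime] [Fact p.Prime]
    (hq8 : q % 8 = 3) (hp8 : p % 8 = 5) (h : Quad K L ((q * p : ℕ) : 𝓞 K) s σ)
    (hnorm : ∀ x : L, algebraMap K L (Algebra.norm K x) = x * σ x)
    (z : 𝓞 K) (hz : z ^ 4 = -1) (hrL : Units.rank L = 3) (P : Sylow 2 (ClassGroup (𝓞 L))) :
    IsCyclic P ∧ Nontrivial P := by
  have := pid8 K
  obtain ⟨π, hπ, hna, hd, h0, h2⟩ := primes4 K q p hq8 hp8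
  have hdv : ∀ i, π i ∣ ((q * p : ℕ) : 𝓞 K) := fun i => by
    rw [hd]; exact Finset.dvd_prod_of_mem _ (Finset.mem_univ i)
  have hdv2 : ∀ i, ¬ π i ^ 2 ∣ ((q * p : ℕ) : 𝓞 K) := fun i => by
    rw [hd]; exact prod_ndvd2 π hπ hna Finset.univ i
  have hkey : KeyProp σ := by
    rintro x _ ⟨u, rfl⟩ hx
    obtain ⟨v, rfl⟩ := h.key q p hq8 hp8 (π 0) (π 2) (hπ 0) (hπ 2) h0 h2 (hdv 0) (hdv 2)
      (hdv2 0) (hdv2 2) z hz u x (congrArg Units.val hx)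
    exact ⟨_, ⟨v, rfl⟩, map_pow _ _ _⟩
  have hz' : algebraMap K L z ^ 4 = -1 := by
    have := congrArg ((algebraMap K L).comp (algebraMap (𝓞 K) K)) hz
    rw [map_pow, map_neg, map_one] at this
    exact this
  have hzK : (z : K) ^ 4 = -1 := by
    have := congrArg (algebraMap (𝓞 K) K) hz
    rwa [map_pow, map_neg, map_one] at this
  have hz0 : (z : K) ^ 2 ≠ 0 := by
    intro h0
    have : (z : K) ^ 4 = ((z : K) ^ 2) ^ 2 := by ring
    rw [hzK, h0] at this
    norm_num at this
  have hM := h.M_rel hkey (Units.mk0 ((z : K) ^ 2) hz0) (by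
    ext; simp only [Units.val_pow_eq_pow_val, Units.val_mk0, Units.val_neg, Units.val_one]
    rw [← hzK]; ring) (rankK K) hrL
  have h8 := h.N2 hkey hM
  have hdL : algebraMap K L (((q * p : ℕ) : 𝓞 K) : K) = ((q * p : ℕ) : L) :=
    map_natCast ((algebraMap K L).comp (algebraMap (𝓞 K) K)) _
  have hs2 := h.ssq
  have h4 : ∃ m : ℕ, 1 + q * p = 4 * m := by
    obtain ⟨m, hm⟩ := Nat.dvd_of_mod_eq_zero (show (1 + q * p) % 4 = 0 by
      rw [Nat.add_mod, Nat.mul_mod, show q % 4 = 3 by omega, show p % 4 = 1 by omega])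
    exact ⟨m, hm⟩
  obtain ⟨m, hm⟩ := h4
  have hmL : (1 : L) + ((q * p : ℕ) : L) = 4 * (m : L) := by exact_mod_cast congrArg (Nat.cast : ℕ → L) hm
  have h2L : (2 : L) ≠ 0 := two_ne_zero
  have hθ : IsIntegral ℤ ((1 + algebraMap K L z ^ 2 * s) / 2) := by
    refine ⟨Polynomial.X ^ 2 - Polynomial.X + Polynomial.C (m : ℤ), ?_, ?_⟩
    · monicity!
    · simp only [Polynomial.eval₂_add, Polynomial.eval₂_sub, Polynomial.eval₂_pow,
        Polynomial.eval₂_X, map_natCast, Polynomial.eval₂_natCast]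
      rw [hdL] at hs2
      linear_combination (1 / 4) * algebraMap K L z ^ 4 * hs2 + (1 / 4) * ((q * p : ℕ) : L) * hz' - (1 / 4) * hmL
  have h16 := h.N1 ((1 + algebraMap K L z ^ 2 * s) / 2) hθ (by
    rw [map_div₀, map_add, map_mul, map_pow, AlgEquiv.commutes, h.conj, map_one, map_ofNat, ← hs2]
    linear_combination s ^ 2 * hz') π hπ hna hd
  exact h.final hkey hnorm h8 h16 P

end
end LdProof

namespace LdProof
open scoped IntermediateField
open Polynomial

theorem d_nonsq (K : Type) [Field K] [NumberField K] [IsCyclotomicExtension {8} ℚ K]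
    (q p : ℕ) [hq : Fact q.Prime] [hp : Fact p.Prime] (hq8 : q % 8 = 3) (hp8 : p % 8 = 5) (k : K) :
    k ^ 2 ≠ ((q * p : ℕ) : K) := by
  intro hk
  obtain ⟨π, hπ, hna, hd, h0, h2⟩ := primes4 K q p hq8 hp8
  have hki : IsIntegral ℤ k := IsIntegral.of_pow (n := 2) (by norm_num) (by
    rw [hk]; exact isIntegral_natCast _)
  obtain ⟨k', hk'⟩ : ∃ k' : 𝓞 K, algebraMap (𝓞 K) K k' = k := ⟨⟨k, hki⟩, rfl⟩
  have hkO : k' ^ 2 = ((q * p : ℕ) : 𝓞 K) := by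
    apply RingOfIntegers.coe_injective
    rw [map_pow, map_natCast, hk']
    exact hk
  apply prod_ndvd2 π hπ hna Finset.univ 0
  rw [← hd, ← hkO]
  apply pow_dvd_pow_of_dvd
  apply (hπ 0).dvd_of_dvd_pow (n := 2)
  rw [hkO, hd]
  exact Finset.dvd_prod_of_mem _ (Finset.mem_univ 0)

theorem exists_quad {K L : Type} [Field K] [NumberField K] [Field L] [NumberField L] [Algebra K L]
    (d : 𝓞 K) (hd : ∀ k : K, k ^ 2 ≠ d) (s : L) (hs : s ^ 2 = algebraMap K L d)
    (rep : ∀ x : L, ∃ a b : K, x = algebraMap K L a + algebraMap K L b * s) :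
    Module.finrank K L = 2 ∧ ∃ σ : L ≃ₐ[K] L, Quad K L d s σ ∧
      ∀ x : L, algebraMap K L (Algebra.norm K x) = x * σ x := by
  classical
  have hirr : Irreducible (X ^ 2 - C (d : K)) := X_pow_sub_C_irreducible_of_prime Nat.prime_two hd
  have hmin : X ^ 2 - C (d : K) = minpoly K s :=
    minpoly.eq_of_irreducible_of_monic hirr (by simp [hs]) (monic_X_pow_sub_C _ two_ne_zero)
  have hsint : IsIntegral K s := Algebra.IsIntegral.isIntegral s
  have htop : K⟮s⟯ = ⊤ := by
    rw [eq_top_iff]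
    intro x _
    obtain ⟨a, b, rfl⟩ := rep x
    exact add_mem (K⟮s⟯.algebraMap_mem a) (mul_mem (K⟮s⟯.algebraMap_mem b)
      (IntermediateField.mem_adjoin_simple_self K s))
  have hfin : Module.finrank K L = 2 := by
    have h1 := IntermediateField.adjoin.finrank hsint
    rw [htop, IntermediateField.finrank_top', ← hmin, natDegree_X_pow_sub_C] at h1
    exact h1
  refine ⟨hfin, ?_⟩
  have : Algebra.IsQuadraticExtension K L := ⟨hfin⟩
  have hcard : Fintype.card (L ≃ₐ[K] L) = 2 := by
    rw [← Nat.card_eq_fintype_card, IsGalois.card_aut_eq_finrank, hfin]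
  obtain ⟨σ, hσ⟩ := Fintype.exists_ne_of_one_lt_card (by rw [hcard]; norm_num) (1 : L ≃ₐ[K] L)
  have hσs : σ s = -s := by
    have h1 : (σ s) ^ 2 = s ^ 2 := by rw [← map_pow, hs, AlgEquiv.commutes]
    rcases sq_eq_sq_iff_eq_or_eq_neg.mp h1 with h2 | h2
    · exfalso
      apply hσ
      ext x
      obtain ⟨a, b, rfl⟩ := rep x
      simp [h2]
    · exact h2
  have hs0 : s ≠ 0 := by
    rintro rfl
    apply hd 0
    apply (algebraMap K L).injective
    rw [← hs, map_pow, map_zero]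
  refine ⟨σ, ⟨hs, hσs, hs0, rep⟩, ?_⟩
  intro x
  rw [Algebra.norm_eq_prod_automorphisms]
  have huniv : (Finset.univ : Finset (L ≃ₐ[K] L)) = {1, σ} := by
    symm
    apply Finset.eq_univ_of_card
    rw [Finset.card_pair hσ.symm, hcard]
  rw [huniv, Finset.prod_pair hσ.symm]
  rfl

theorem rankL (L : Type) [Field L] [NumberField L] (ζ : L) (hζ : IsPrimitiveRoot ζ 8)
    (h : Module.finrank ℚ L = 8) : Units.rank L = 3 := by
  have h1 := NumberField.InfinitePlace.IsPrimitiveRoot.nrRealPlaces_eq_zero_of_two_lt (by norm_num) hζ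
  have h2 := InfinitePlace.card_add_two_mul_card_eq_rank L
  unfold Units.rank
  rw [InfinitePlace.card_eq_nrRealPlaces_add_nrComplexPlaces]
  omega

theorem main (q p : ℕ) (hq : q.Prime) (hp : p.Prime) (hq8 : q % 8 = 3) (hp8 : p % 8 = 5)
    (L : Type) [Field L] [NumberField L] (ζ : L) (hζ : IsPrimitiveRoot ζ 8)
    (s : L) (hs : s ^ 2 = ((q * p : ℕ) : L)) (hgen : Algebra.adjoin ℚ {ζ, s} = ⊤)
    (P : Sylow 2 (ClassGroup (𝓞 L))) : IsCyclic P ∧ Nontrivial P := by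
  have : Fact q.Prime := ⟨hq⟩
  have : Fact p.Prime := ⟨hp⟩
  have hcyc : IsCyclotomicExtension {8} ℚ ℚ⟮ζ⟯ :=
    hζ.intermediateField_adjoin_isCyclotomicExtension ℚ
  have : NumberField ℚ⟮ζ⟯ := NumberField.of_intermediateField _
  have hz4 : ζ ^ 4 = -1 := by
    have h8 : (ζ ^ 4) ^ 2 = 1 := by rw [← pow_mul]; exact hζ.pow_eq_one
    rcases sq_eq_one_iff.mp h8 with h | h
    · exact absurd h (hζ.pow_ne_one_of_pos_of_lt (by norm_num) (by norm_num))
    · exact h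
  have hsd : s ^ 2 = algebraMap ℚ⟮ζ⟯ L (((q * p : ℕ) : 𝓞 ℚ⟮ζ⟯) : ℚ⟮ζ⟯) := by
    rw [hs]
    exact (map_natCast ((algebraMap ℚ⟮ζ⟯ L).comp (algebraMap (𝓞 ℚ⟮ζ⟯) ℚ⟮ζ⟯)) _).symm
  have hrep : ∀ x : L, ∃ a b : ℚ⟮ζ⟯, x = algebraMap ℚ⟮ζ⟯ L a + algebraMap ℚ⟮ζ⟯ L b * s := by
    intro x
    have hx : x ∈ Algebra.adjoin ℚ {ζ, s} := by rw [hgen]; trivial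
    induction hx using Algebra.adjoin_induction with
    | mem x hx =>
      rcases hx with rfl | hx
      · exact ⟨IntermediateField.AdjoinSimple.gen ℚ x, 0, by simp⟩
      · rw [Set.mem_singleton_iff] at hx
        exact ⟨0, 1, by simp [hx]⟩
    | algebraMap r =>
      exact ⟨algebraMap ℚ ℚ⟮ζ⟯ r, 0, by simp⟩
    | add x y _ _ hx hy =>
      obtain ⟨a, b, rfl⟩ := hx
      obtain ⟨a', b', rfl⟩ := hy
      exact ⟨a + a', b + b', by rw [map_add, map_add]; ring⟩
    | mul x y _ _ hx hy =>
      obtain ⟨a, b, rfl⟩ := hx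
      obtain ⟨a', b', rfl⟩ := hy
      refine ⟨a * a' + b * b' * (((q * p : ℕ) : 𝓞 ℚ⟮ζ⟯) : ℚ⟮ζ⟯), a * b' + b * a', ?_⟩
      rw [map_add, map_add, map_mul, map_mul, map_mul, map_mul, map_mul, ← hsd]
      ring
  obtain ⟨hfin, σ, hquad, hnorm⟩ := exists_quad (((q * p : ℕ) : 𝓞 ℚ⟮ζ⟯))
    (fun k hk => d_nonsq ℚ⟮ζ⟯ q p hq8 hp8 k (hk.trans (map_natCast (algebraMap (𝓞 ℚ⟮ζ⟯) ℚ⟮ζ⟯) _))) s hsd hrep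
  have hz : IsIntegral ℤ (IntermediateField.AdjoinSimple.gen ℚ ζ) := by
    rw [← isIntegral_algebraMap_iff (algebraMap ℚ⟮ζ⟯ L).injective]
    exact IsIntegral.of_pow (n := 4) (by norm_num) (by
      change IsIntegral ℤ (ζ ^ 4)
      rw [hz4]; exact isIntegral_one.neg)
  have hf8 : Module.finrank ℚ L = 8 := by
    rw [← Module.finrank_mul_finrank ℚ ℚ⟮ζ⟯ L, hfin,
      IsCyclotomicExtension.finrank (n := 8) ℚ⟮ζ⟯ (cyclotomic.irreducible_rat (by norm_num)),
      show Nat.totient 8 = 4 by decide]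
  obtain ⟨z, hzz⟩ : ∃ z : 𝓞 ℚ⟮ζ⟯, algebraMap ℚ⟮ζ⟯ L (algebraMap (𝓞 ℚ⟮ζ⟯) ℚ⟮ζ⟯ z) = ζ :=
    ⟨⟨_, hz⟩, rfl⟩
  refine hquad.conclude q p hq8 hp8 hnorm z ?_ (rankL L ζ hζ hf8) P
  apply RingOfIntegers.coe_injective
  apply (algebraMap ℚ⟮ζ⟯ L).injective
  rw [map_pow, map_pow, map_neg, map_neg, map_one, map_one, hzz]
  exact hz4

end LdProof


/-- Let `q ≡ 3 (mod 8)` and `p ≡ 5 (mod 8)` be primes and `d = qp`. Then the 2-class group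
of `L_d = ℚ(ζ₈, √d)` is cyclic and nontrivial. -/
theorem stmt_18 (q p : ℕ) (hq : q.Prime) (hp : p.Prime)
    (hq8 : q % 8 = 3) (hp8 : p % 8 = 5)
    (L : Type) [Field L] [NumberField L]
    (ζ : L) (hζ : IsPrimitiveRoot ζ 8) (s : L) (hs : s ^ 2 = ((q * p : ℕ) : L))
    (hgen : Algebra.adjoin ℚ {ζ, s} = ⊤) :
    ∀ P : Sylow 2 (ClassGroup (𝓞 L)), IsCyclic P ∧ Nontrivial P := by
  exact fun P => LdProof.main q p hq hp hq8 hp8 L ζ hζ s hs hgen P
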